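/- arXiv:2003.10953 — 9 statements merged into one kernel-verified Lean document; each statement's English description precedes it below -/
import Mathlib

section
/- For every p ∈ (0,1) and every Lebesgue measurable integrable function f : (0,∞) → [0,∞), one has ∫₀^∞ ((1/x)∫₀^x f(t)^p dt)^{1/p} dx ≤ (1−p)^{−1/p} ∫₀^∞ f(x) dx. -/
open MeasureTheory Set Real

open scoped ENNReal

/-- Hölder's inequality against the weight `t ^ (1 - p)`. -/
lemma lintegral_rpow_Ioo_le_weighted {p x : ℝ} (hp0 : 0 < p) (hp1 : p < 1) (hx : 0 < x)
    {F : ℝ → ℝ≥0∞} (hF : Measurable F) :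
    ∫⁻ t in Ioo 0 x, F t ^ p ≤
      (∫⁻ t in Ioo 0 x, F t * ENNReal.ofReal (t ^ (1 - p))) ^ p *
        ENNReal.ofReal (x ^ (1 - p) / (1 - p)) ^ (1 - p) := by
  have hw : ∫⁻ t in Ioo 0 x, ENNReal.ofReal (t ^ (-p)) =
      ENNReal.ofReal (x ^ (1 - p) / (1 - p)) := by
    have hi : IntegrableOn (fun t : ℝ => t ^ (-p)) (Ioo 0 x) :=
      (intervalIntegral.integrableOn_Ioo_rpow_iff hx).2 (by linarith)
    rw [← ofReal_integral_eq_lintegral_ofReal hi, ← integral_Ioc_eq_integral_Ioo,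
      ← intervalIntegral.integral_of_le hx.le, integral_rpow (Or.inl (by linarith)),
      zero_rpow (by linarith), sub_zero, neg_add_eq_sub]
    filter_upwards [ae_restrict_mem measurableSet_Ioo] with t ht
    exact rpow_nonneg ht.1.le _
  calc ∫⁻ t in Ioo 0 x, F t ^ p
      = ∫⁻ t in Ioo 0 x, (F t * ENNReal.ofReal (t ^ (1 - p))) ^ p *
          ENNReal.ofReal (t ^ (-p)) ^ (1 - p) := by
        refine setLIntegral_congr_fun measurableSet_Ioo fun t ht => ?_
        have h0 : 0 < t := ht.1
        rw [ENNReal.mul_rpow_of_nonneg _ _ hp0.le, mul_assoc,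
          ENNReal.ofReal_rpow_of_pos (by positivity), ENNReal.ofReal_rpow_of_pos (by positivity),
          ← ENNReal.ofReal_mul (by positivity), ← rpow_mul h0.le, ← rpow_mul h0.le,
          ← rpow_add h0]
        ring_nf
        simp
    _ ≤ _ := by
        rw [← hw]
        exact ENNReal.lintegral_mul_norm_pow_le (by fun_prop) (by fun_prop) hp0.le
          (by linarith) (by ring)

lemma lintegral_Ioi_rpow_sub_two {p t : ℝ} (hp1 : p < 1) (ht : 0 < t) :
    ∫⁻ x in Ioi t, ENNReal.ofReal (x ^ (p - 2)) = ENNReal.ofReal (t ^ (p - 1) / (1 - p)) := by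
  rw [← ofReal_integral_eq_lintegral_ofReal
    (integrableOn_Ioi_rpow_of_lt (by linarith) ht), integral_Ioi_rpow_of_lt (by linarith) ht]
  · congr 1
    rw [show p - 2 + 1 = p - 1 by ring, neg_div, ← div_neg, neg_sub]
  · filter_upwards [ae_restrict_mem measurableSet_Ioi] with x hx
    exact rpow_nonneg (ht.trans hx).le _

/-- The weighted Hardy operator has constant `L¹` norm. -/
lemma lintegral_rpow_mul_lintegral_Ioo {p : ℝ} (hp1 : p < 1) {F : ℝ → ℝ≥0∞}
    (hF : Measurable F) :
    ∫⁻ x in Ioi (0 : ℝ), ENNReal.ofReal (x ^ (p - 2)) *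
        ∫⁻ t in Ioo 0 x, F t * ENNReal.ofReal (t ^ (1 - p)) =
      ENNReal.ofReal (1 / (1 - p)) * ∫⁻ t in Ioi (0 : ℝ), F t := by
  set k : ℝ → ℝ → ℝ≥0∞ := fun x t =>
    {z : ℝ × ℝ | z.2 < z.1}.indicator
      (fun z => ENNReal.ofReal (z.1 ^ (p - 2)) * (F z.2 * ENNReal.ofReal (z.2 ^ (1 - p)))) (x, t)
    with hk
  have hkm : Measurable (Function.uncurry k) := by
    refine Measurable.indicator ?_ (measurableSet_lt measurable_snd measurable_fst)
    fun_prop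
  calc _ = ∫⁻ x in Ioi (0 : ℝ), ∫⁻ t in Ioi (0 : ℝ), k x t := by
        refine setLIntegral_congr_fun measurableSet_Ioi fun x _ => ?_
        have : ∀ t, k x t = (Iio x).indicator (fun t => ENNReal.ofReal (x ^ (p - 2)) *
            (F t * ENNReal.ofReal (t ^ (1 - p)))) t := fun t => by simp [hk, indicator]
        simp only [this]
        rw [lintegral_indicator measurableSet_Iio, Measure.restrict_restrict measurableSet_Iio,
          Iio_inter_Ioi, lintegral_const_mul _ (by fun_prop)]
    _ = ∫⁻ t in Ioi (0 : ℝ), ∫⁻ x in Ioi (0 : ℝ), k x t :=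
        lintegral_lintegral_swap hkm.aemeasurable
    _ = ∫⁻ t in Ioi (0 : ℝ), ENNReal.ofReal (1 / (1 - p)) * F t := by
        refine setLIntegral_congr_fun measurableSet_Ioi fun t (ht : 0 < t) => ?_
        have : ∀ x, k x t = (Ioi t).indicator (fun x => ENNReal.ofReal (x ^ (p - 2)) *
            (F t * ENNReal.ofReal (t ^ (1 - p)))) x := fun x => by simp [hk, indicator]
        simp only [this]
        rw [lintegral_indicator measurableSet_Ioi, Measure.restrict_restrict measurableSet_Ioi,
          Ioi_inter_Ioi, sup_of_le_left ht.le, lintegral_mul_const _ (by fun_prop),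
          lintegral_Ioi_rpow_sub_two hp1 ht, mul_comm (F t), ← mul_assoc,
          ← ENNReal.ofReal_mul (div_nonneg (by positivity) (by linarith)), div_mul_eq_mul_div,
          ← rpow_add ht]
        simp
    _ = _ := lintegral_const_mul _ hF

/-- Pointwise bound of the power mean by the weighted Hardy operator. -/
lemma power_mean_le_weighted {p x : ℝ} (hp0 : 0 < p) (hp1 : p < 1) (hx : 0 < x)
    {F : ℝ → ℝ≥0∞} (hF : Measurable F) :
    (ENNReal.ofReal (1 / x) * ∫⁻ t in Ioo 0 x, F t ^ p) ^ (1 / p) ≤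
      ENNReal.ofReal ((1 - p) ^ (1 - 1 / p)) * (ENNReal.ofReal (x ^ (p - 2)) *
        ∫⁻ t in Ioo 0 x, F t * ENNReal.ofReal (t ^ (1 - p))) := by
  have hq : 0 < 1 - p := by linarith
  have hconst : (1 / x) ^ (1 / p) * ((x ^ (1 - p) / (1 - p)) ^ (1 - p)) ^ (1 / p) =
      (1 - p) ^ (1 - 1 / p) * x ^ (p - 2) := by
    rw [← rpow_mul (by positivity), div_rpow (by positivity) hq.le, one_div x,
      inv_rpow hx.le, ← rpow_neg hx.le, ← rpow_mul hx.le, div_eq_mul_inv (x ^ _), ← rpow_neg hq.le,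
      ← mul_assoc, ← rpow_add hx, mul_comm]
    congr 2 <;> field_simp <;> ring
  calc _ ≤ (ENNReal.ofReal (1 / x) *
        ((∫⁻ t in Ioo 0 x, F t * ENNReal.ofReal (t ^ (1 - p))) ^ p *
        ENNReal.ofReal (x ^ (1 - p) / (1 - p)) ^ (1 - p))) ^ (1 / p) := by
        gcongr
        exact lintegral_rpow_Ioo_le_weighted hp0 hp1 hx hF
    _ = _ := by
        have h1 : 0 ≤ 1 / p := by positivity
        rw [ENNReal.mul_rpow_of_nonneg _ _ h1, ENNReal.mul_rpow_of_nonneg _ _ h1,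
          ← ENNReal.rpow_mul, mul_one_div_cancel hp0.ne', ENNReal.rpow_one,
          ENNReal.ofReal_rpow_of_pos (by positivity), ENNReal.ofReal_rpow_of_pos (by positivity),
          ENNReal.ofReal_rpow_of_pos (by positivity),
          mul_comm (∫⁻ t in Ioo 0 x, F t * ENNReal.ofReal (t ^ (1 - p))), ← mul_assoc,
          ← mul_assoc, ← ENNReal.ofReal_mul (by positivity), ← ENNReal.ofReal_mul (by positivity),
          hconst]

/-- Hardy's inequality for power means of `ℝ≥0∞`-valued functions. -/
lemma lintegral_hardy_power_mean {p : ℝ} (hp0 : 0 < p) (hp1 : p < 1)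
    {F : ℝ → ℝ≥0∞} (hF : Measurable F) :
    ∫⁻ x in Ioi (0 : ℝ), (ENNReal.ofReal (1 / x) * ∫⁻ t in Ioo 0 x, F t ^ p) ^ (1 / p) ≤
      ENNReal.ofReal ((1 - p) ^ (-(1 / p))) * ∫⁻ x in Ioi (0 : ℝ), F x := by
  have hq : 0 < 1 - p := by linarith
  calc _ ≤ ∫⁻ x in Ioi (0 : ℝ), ENNReal.ofReal ((1 - p) ^ (1 - 1 / p)) *
        (ENNReal.ofReal (x ^ (p - 2)) *
          ∫⁻ t in Ioo 0 x, F t * ENNReal.ofReal (t ^ (1 - p))) :=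
        setLIntegral_mono' measurableSet_Ioi fun x hx => power_mean_le_weighted hp0 hp1 hx hF
    _ = _ := by
        rw [lintegral_const_mul' _ _ ENNReal.ofReal_ne_top,
          lintegral_rpow_mul_lintegral_Ioo hp1 hF, ← mul_assoc,
          ← ENNReal.ofReal_mul (by positivity), sub_eq_neg_add 1 (1 / p), rpow_add hq, rpow_one, mul_assoc,
          mul_one_div_cancel hq.ne', mul_one]

/-- Integral Hardy inequality for power means, case `p ∈ (0,1)`. -/
theorem integral_hardy_power_mean_pos (p : ℝ) (hp : p ∈ Set.Ioo (0:ℝ) 1)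
    (f : ℝ → ℝ) (hmeas : Measurable f)
    (hint : IntegrableOn f (Set.Ioi 0))
    (hpos : ∀ x ∈ Set.Ioi (0:ℝ), 0 ≤ f x) :
    ∫ x in Set.Ioi (0:ℝ), ((1/x) * ∫ t in Set.Ioo (0:ℝ) x, f t ^ p) ^ (1/p)
      ≤ (1 - p) ^ (-(1/p)) * ∫ x in Set.Ioi (0:ℝ), f x := by
  obtain ⟨hp0, hp1⟩ := hp
  have hq : 0 < 1 - p := by linarith
  have hI : 0 ≤ ∫ x in Ioi (0 : ℝ), f x := setIntegral_nonneg measurableSet_Ioi hpos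
  have hmean : ∀ x ∈ Ioi (0 : ℝ),
      ENNReal.ofReal ‖((1 / x) * ∫ t in Ioo (0 : ℝ) x, f t ^ p) ^ (1 / p)‖ ≤
        (ENNReal.ofReal (1 / x) * ∫⁻ t in Ioo 0 x, ENNReal.ofReal (f t) ^ p) ^ (1 / p) := by
    intro x (hx : 0 < x)
    have hJ : 0 ≤ ∫ t in Ioo (0 : ℝ) x, f t ^ p :=
      setIntegral_nonneg measurableSet_Ioo fun t ht => rpow_nonneg (hpos t ht.1) _
    rw [norm_of_nonneg (by positivity),
      ← ENNReal.ofReal_rpow_of_nonneg (by positivity) (by positivity),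
      ENNReal.ofReal_mul (by positivity)]
    gcongr
    refine (ENNReal.ofReal_le_ofReal (le_norm_self _)).trans ?_
    refine (ENNReal.ofReal_le_of_le_toReal (norm_integral_le_lintegral_norm _)).trans_eq ?_
    refine setLIntegral_congr_fun measurableSet_Ioo fun t ht => ?_
    have h0 := hpos t ht.1
    rw [norm_of_nonneg (by positivity), ENNReal.ofReal_rpow_of_nonneg h0 hp0.le]
  refine (le_norm_self _).trans ((norm_integral_le_lintegral_norm _).trans ?_)
  refine ENNReal.toReal_le_of_le_ofReal (by positivity) ?_
  calc _ ≤ _ := setLIntegral_mono' measurableSet_Ioi hmean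
    _ ≤ _ := lintegral_hardy_power_mean hp0 hp1 hmeas.ennreal_ofReal
    _ = _ := by
      rw [ENNReal.ofReal_mul (by positivity), ofReal_integral_eq_lintegral_ofReal hint
        ((ae_restrict_mem measurableSet_Ioi).mono hpos)]
end

section
/- For every p < 0 and every Lebesgue measurable integrable function f : (0,∞) → (0,∞) such that f^p is integrable on (0,x) for every x > 0, one has ∫₀^∞ ((1/x)∫₀^x f(t)^p dt)^{1/p} dx ≤ (1−p)^{−1/p} ∫₀^∞ f(x) dx. -/
open MeasureTheory Set Real

/-- Multiplying an integrable function on `(0, x)` by a nonnegative power keeps it integrable. -/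
lemma integrableOn_mul_rpow_Ioo {f : ℝ → ℝ} (hmeas : Measurable f)
    (hint : IntegrableOn f (Ioi 0)) {a : ℝ} (ha : 0 ≤ a) (x : ℝ) :
    IntegrableOn (fun t => f t * t ^ a) (Ioo 0 x) := by
  have h1 : IntegrableOn (fun t => x ^ a * f t) (Ioo 0 x) :=
    (hint.mono_set Ioo_subset_Ioi_self).const_mul _
  refine Integrable.mono h1 (by fun_prop) ?_
  filter_upwards [ae_restrict_mem measurableSet_Ioo] with t ht
  rw [norm_mul, norm_mul, mul_comm]
  have h2 : t ^ a ≤ x ^ a := rpow_le_rpow ht.1.le ht.2.le ha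
  rw [norm_of_nonneg (rpow_nonneg ht.1.le a),
    norm_of_nonneg (rpow_nonneg (ht.1.trans ht.2).le a)]
  gcongr

/-- Hölder's inequality on `(0, x)` for
`t ^ q = (f t * t ^ (1 + q)) ^ (q / (1 + q)) * (f t ^ (-q)) ^ (1 / (1 + q))`. -/
lemma rpow_div_le_holder {q : ℝ} (hq : 0 < q) {f : ℝ → ℝ} (hmeas : Measurable f)
    (hint : IntegrableOn f (Ioi 0)) (hpos : ∀ x ∈ Ioi (0 : ℝ), 0 < f x) {x : ℝ} (hx : 0 < x)
    (hloc : IntegrableOn (fun t => f t ^ (-q)) (Ioo 0 x)) :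
    x ^ (1 + q) / (1 + q) ≤
      (∫ t in Ioo 0 x, f t * t ^ (1 + q)) ^ (q / (1 + q)) *
        (∫ t in Ioo 0 x, f t ^ (-q)) ^ (1 / (1 + q)) := by
  have hq1 : 0 < 1 + q := by linarith
  have hconj : ((1 + q) / q).HolderConjugate (1 + q) := by
    rw [Real.holderConjugate_iff]
    refine ⟨by rw [lt_div_iff₀ hq]; linarith, ?_⟩
    field_simp
    ring
  set u : ℝ → ℝ := fun t => (f t * t ^ (1 + q)) ^ (q / (1 + q)) with hu
  set v : ℝ → ℝ := fun t => (f t ^ (-q)) ^ (1 / (1 + q)) with hv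
  have hum : Measurable u := by fun_prop
  have hvm : Measurable v := by fun_prop
  have hu0 : ∀ t ∈ Ioo 0 x, 0 ≤ u t := fun t ht =>
    rpow_nonneg (mul_nonneg (hpos t ht.1).le (rpow_nonneg ht.1.le _)) _
  have hv0 : ∀ t ∈ Ioo 0 x, 0 ≤ v t := fun t ht =>
    rpow_nonneg (rpow_nonneg (hpos t ht.1).le _) _
  have hup : ∀ t ∈ Ioo 0 x, u t ^ ((1 + q) / q) = f t * t ^ (1 + q) := fun t ht => by
    rw [hu, ← rpow_mul (mul_nonneg (hpos t ht.1).le (rpow_nonneg ht.1.le _)),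
      div_mul_div_cancel₀ hq1.ne', div_self hq.ne', rpow_one]
  have hvq : ∀ t ∈ Ioo 0 x, v t ^ (1 + q) = f t ^ (-q) := fun t ht => by
    rw [hv, ← rpow_mul (rpow_nonneg (hpos t ht.1).le _), one_div_mul_cancel hq1.ne', rpow_one]
  have huv : ∀ t ∈ Ioo 0 x, u t * v t = t ^ q := fun t ht => by
    have hf := hpos t ht.1
    rw [hu, hv]
    simp only
    rw [mul_rpow hf.le (rpow_nonneg ht.1.le _), ← rpow_mul ht.1.le, ← rpow_mul hf.le,
      mul_right_comm, ← rpow_add hf, mul_div_cancel₀ _ hq1.ne',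
      show q / (1 + q) + -q * (1 / (1 + q)) = 0 by ring, rpow_zero, one_mul]
  have hmem : ∀ {w g : ℝ → ℝ} {r : ℝ}, 0 < r → Measurable w → (∀ t ∈ Ioo 0 x, 0 ≤ w t) →
      (∀ t ∈ Ioo 0 x, w t ^ r = g t) → IntegrableOn g (Ioo 0 x) →
      MemLp w (ENNReal.ofReal r) (volume.restrict (Ioo 0 x)) := by
    intro w g r hr hw hw0 hwg hg
    rw [← integrable_norm_rpow_iff hw.aestronglyMeasurable (by simpa using hr)
      ENNReal.ofReal_ne_top, ENNReal.toReal_ofReal hr.le]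
    refine hg.congr_fun (fun t ht => ?_) measurableSet_Ioo
    simp only [norm_of_nonneg (hw0 t ht), hwg t ht]
  have key := integral_mul_le_Lp_mul_Lq_of_nonneg (μ := volume.restrict (Ioo 0 x)) hconj
    (ae_restrict_of_forall_mem measurableSet_Ioo hu0)
    (ae_restrict_of_forall_mem measurableSet_Ioo hv0)
    (hmem (by positivity) hum hu0 hup (integrableOn_mul_rpow_Ioo hmeas hint hq1.le x))
    (hmem hq1 hvm hv0 hvq hloc)
  rw [setIntegral_congr_fun measurableSet_Ioo huv, setIntegral_congr_fun measurableSet_Ioo hup,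
    setIntegral_congr_fun measurableSet_Ioo hvq, one_div_div] at key
  refine le_of_eq_of_le ?_ key
  rw [← integral_Ioc_eq_integral_Ioo, ← intervalIntegral.integral_of_le hx.le,
    integral_rpow (Or.inl (by linarith)), add_comm q 1, zero_rpow hq1.ne', sub_zero]

/-- The power mean of order `-q` is controlled by a weighted arithmetic mean. -/
lemma power_mean_neg_le {q : ℝ} (hq : 0 < q) {f : ℝ → ℝ} (hmeas : Measurable f)
    (hint : IntegrableOn f (Ioi 0)) (hpos : ∀ x ∈ Ioi (0 : ℝ), 0 < f x) {x : ℝ} (hx : 0 < x)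
    (hloc : IntegrableOn (fun t => f t ^ (-q)) (Ioo 0 x)) :
    ((1 / x) * ∫ t in Ioo 0 x, f t ^ (-q)) ^ (1 / (-q)) ≤
      (1 + q) ^ ((1 + q) / q) * (x ^ (-2 - q) * ∫ t in Ioo 0 x, f t * t ^ (1 + q)) := by
  have hq1 : 0 < 1 + q := by linarith
  have key := rpow_div_le_holder hq hmeas hint hpos hx hloc
  have hA0 : 0 ≤ ∫ t in Ioo 0 x, f t * t ^ (1 + q) :=
    setIntegral_nonneg measurableSet_Ioo fun t ht =>
      mul_nonneg (hpos t ht.1).le (rpow_nonneg ht.1.le _)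
  have hB0 : 0 ≤ ∫ t in Ioo 0 x, f t ^ (-q) :=
    setIntegral_nonneg measurableSet_Ioo fun t ht => rpow_nonneg (hpos t ht.1).le _
  set A := ∫ t in Ioo 0 x, f t * t ^ (1 + q)
  set B := ∫ t in Ioo 0 x, f t ^ (-q)
  have hl : 0 < x ^ (1 + q) / (1 + q) := by positivity
  have hA : 0 < A := by
    refine hA0.lt_of_ne fun h => ?_
    rw [← h, zero_rpow (by positivity), zero_mul] at key
    linarith
  have hB : 0 < B := by
    refine hB0.lt_of_ne fun h => ?_
    rw [← h, zero_rpow (by positivity), mul_zero] at key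
    linarith
  have hlog := log_le_log hl key
  rw [log_div (by positivity) hq1.ne', log_mul (by positivity) (by positivity), log_rpow hx,
    log_rpow hA, log_rpow hB] at hlog
  rw [← log_le_log_iff (by positivity) (by positivity), log_rpow (by positivity),
    log_mul (by positivity) hB.ne', log_mul (by positivity) (by positivity),
    log_mul (by positivity) hA.ne', log_rpow hq1, log_rpow hx, one_div x, log_inv]
  have h := mul_le_mul_of_nonneg_left hlog (show 0 ≤ (1 + q) / q by positivity)
  have e1 : (1 + q) / q * (q / (1 + q) * log A + 1 / (1 + q) * log B) = log A + log B / q := by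
    field_simp
  have e2 : (1 + q) / q * ((1 + q) * log x - log (1 + q)) =
      log x / q + (2 + q) * log x - (1 + q) / q * log (1 + q) := by
    field_simp
    ring
  have e3 : 1 / -q * (-log x + log B) = log x / q - log B / q := by
    field_simp
    ring
  rw [e1, e2] at h
  rw [e3]
  linarith

/-- Fubini for the weighted Hardy operator: its integral is a multiple of the integral of `f`. -/
lemma integral_weighted_hardy {a : ℝ} (ha : 0 < a) {f : ℝ → ℝ} (hmeas : Measurable f)
    (hint : IntegrableOn f (Ioi 0)) :
    IntegrableOn (fun x => x ^ (-1 - a) * ∫ t in Ioo 0 x, f t * t ^ a) (Ioi 0) ∧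
      ∫ x in Ioi (0 : ℝ), x ^ (-1 - a) * ∫ t in Ioo 0 x, f t * t ^ a =
        (1 / a) * ∫ x in Ioi (0 : ℝ), f x := by
  set μ : Measure ℝ := volume.restrict (Ioi 0) with hμ
  set F : ℝ × ℝ → ℝ := {z : ℝ × ℝ | z.2 < z.1}.indicator
    (fun z => z.1 ^ (-1 - a) * (f z.2 * z.2 ^ a)) with hF
  have hFm : Measurable F := by
    refine Measurable.indicator (by fun_prop) (measurableSet_lt measurable_snd measurable_fst)
  have hFx : ∀ x t, F (x, t) = (Iio x).indicator
      (fun t => x ^ (-1 - a) * (f t * t ^ a)) t := fun x t => by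
    simp [hF, indicator_apply]
  have hFt : ∀ x t, F (x, t) = (Ioi t).indicator
      (fun x => (f t * t ^ a) * x ^ (-1 - a)) x := fun x t => by
    simp [hF, indicator_apply, mul_comm]
  have hinner : ∀ x, ∫ t, F (x, t) ∂μ = x ^ (-1 - a) * ∫ t in Ioo 0 x, f t * t ^ a := fun x => by
    simp_rw [hFx, hμ]
    rw [setIntegral_indicator measurableSet_Iio, Ioi_inter_Iio, integral_const_mul]
  have hpow : ∀ {t : ℝ}, 0 < t → ∀ c : ℝ,
      ∫ x in Ioi t, c * t ^ a * x ^ (-1 - a) = 1 / a * c := fun {t} ht c => by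
    rw [integral_const_mul, integral_Ioi_rpow_of_lt (by linarith) ht,
      show -1 - a + 1 = -a by ring, rpow_neg ht.le]
    have := (rpow_pos_of_pos ht a).ne'
    field_simp
  have hinter : ∀ {t : ℝ}, 0 < t → Ioi 0 ∩ Ioi t = Ioi t := fun ht => by
    rw [Ioi_inter_Ioi, max_eq_right ht.le]
  have houter : ∀ t ∈ Ioi (0 : ℝ), ∫ x, F (x, t) ∂μ = 1 / a * f t := fun t ht => by
    simp_rw [hFt, hμ]
    rw [setIntegral_indicator measurableSet_Ioi, hinter ht, hpow ht]
  have hnorm : ∀ t ∈ Ioi (0 : ℝ), ∫ x, ‖F (x, t)‖ ∂μ = 1 / a * ‖f t‖ := fun t ht => by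
    simp_rw [hFt, hμ, norm_indicator_eq_indicator_norm]
    rw [setIntegral_indicator measurableSet_Ioi, hinter ht, ← hpow ht]
    refine setIntegral_congr_fun measurableSet_Ioi fun x hx => ?_
    simp only [norm_mul]
    rw [norm_of_nonneg (rpow_nonneg (le_of_lt ht) a),
      norm_of_nonneg (rpow_nonneg (lt_trans ht hx).le (-1 - a))]
  have hFi : Integrable F (μ.prod μ) := by
    rw [integrable_prod_iff' hFm.aestronglyMeasurable]
    constructor
    · filter_upwards [ae_restrict_mem measurableSet_Ioi] with t ht
      simp_rw [hFt]
      rw [integrable_indicator_iff measurableSet_Ioi, IntegrableOn, hμ,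
        Measure.restrict_restrict measurableSet_Ioi, inter_comm, hinter ht]
      exact (integrableOn_Ioi_rpow_of_lt (by linarith) ht).const_mul _
    · refine (hint.norm.const_mul (1 / a)).congr ?_
      filter_upwards [ae_restrict_mem measurableSet_Ioi] with t ht
      exact (hnorm t ht).symm
  refine ⟨?_, ?_⟩
  · rw [IntegrableOn]
    simpa only [hinner] using hFi.integral_prod_left
  · calc ∫ x, x ^ (-1 - a) * (∫ t in Ioo 0 x, f t * t ^ a) ∂μ
        = ∫ x, ∫ t, F (x, t) ∂μ ∂μ := by simp only [hinner]
      _ = ∫ t, ∫ x, F (x, t) ∂μ ∂μ := integral_integral_swap (f := fun x t => F (x, t)) hFi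
      _ = ∫ t, 1 / a * f t ∂μ := setIntegral_congr_fun measurableSet_Ioi houter
      _ = 1 / a * ∫ t, f t ∂μ := integral_const_mul _ _

/-- Integral Hardy inequality for power means, case `p < 0` (Knopp). -/
theorem integral_hardy_power_mean_neg (p : ℝ) (hp : p < 0)
    (f : ℝ → ℝ) (hmeas : Measurable f)
    (hint : IntegrableOn f (Set.Ioi 0))
    (hpos : ∀ x ∈ Set.Ioi (0:ℝ), 0 < f x)
    (hploc : ∀ x ∈ Set.Ioi (0:ℝ), IntegrableOn (fun t => f t ^ p) (Set.Ioo 0 x)) :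
    ∫ x in Set.Ioi (0:ℝ), ((1/x) * ∫ t in Set.Ioo (0:ℝ) x, f t ^ p) ^ (1/p)
      ≤ (1 - p) ^ (-(1/p)) * ∫ x in Set.Ioi (0:ℝ), f x := by
  obtain ⟨q, rfl⟩ : ∃ q, p = -q := ⟨-p, by ring⟩
  have hq : 0 < q := by linarith
  have hq1 : 0 < 1 + q := by linarith
  obtain ⟨hGi, hG⟩ := integral_weighted_hardy hq1 hmeas hint
  rw [show -1 - (1 + q) = -2 - q by ring] at hGi hG
  have hconst : (1 - -q) ^ (-(1 / -q)) = (1 + q) ^ ((1 + q) / q) * (1 / (1 + q)) := by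
    rw [sub_neg_eq_add, show -(1 / -q) = (1 + q) / q - 1 by field_simp; ring,
      rpow_sub_one hq1.ne', mul_one_div]
  calc ∫ x in Ioi (0 : ℝ), ((1 / x) * ∫ t in Ioo (0 : ℝ) x, f t ^ (-q)) ^ (1 / -q)
      ≤ ∫ x in Ioi (0 : ℝ), (1 + q) ^ ((1 + q) / q) *
          (x ^ (-2 - q) * ∫ t in Ioo 0 x, f t * t ^ (1 + q)) := by
        refine integral_mono_of_nonneg ?_ (hGi.const_mul _) ?_
        · filter_upwards [ae_restrict_mem measurableSet_Ioi] with x hx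
          refine rpow_nonneg (mul_nonneg (one_div_nonneg.2 (le_of_lt hx)) ?_) _
          exact setIntegral_nonneg measurableSet_Ioo fun t ht => rpow_nonneg (hpos t ht.1).le _
        · filter_upwards [ae_restrict_mem measurableSet_Ioi] with x hx
          exact power_mean_neg_le hq hmeas hint hpos hx (hploc x hx)
    _ = (1 - -q) ^ (-(1 / -q)) * ∫ x in Ioi (0 : ℝ), f x := by
        rw [integral_const_mul, hG, hconst, mul_assoc]
end

section
/- For every Lebesgue measurable integrable function f : (0,∞) → (0,∞) such that t ↦ ln f(t) is integrable on (0,x) for every x > 0, one has ∫₀^∞ exp((1/x)∫₀^x ln f(t) dt) dx ≤ e ∫₀^∞ f(x) dx. -/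
open MeasureTheory Set Real

/-- Jensen's inequality for the geometric mean of `t ↦ t * f t` over `(0, x)`, rewritten as a bound
on the geometric mean of `f`. -/
lemma exp_average_log_le {f : ℝ → ℝ} {x : ℝ} (hx : 0 < x)
    (hpos : ∀ t ∈ Ioo 0 x, 0 < f t) (hint : IntegrableOn (fun t => t * f t) (Ioo 0 x))
    (hlog : IntegrableOn (fun t => log (f t)) (Ioo 0 x)) :
    exp ((1 / x) * ∫ t in Ioo 0 x, log (f t)) ≤ exp 1 / x ^ 2 * ∫ t in Ioo 0 x, t * f t := by
  set A := (1 / x) * ∫ t in Ioo 0 x, log (f t) with hA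
  set a := A + log x - 1 with ha
  have hlogt : IntegrableOn log (Ioo 0 x) :=
    ((intervalIntegrable_iff_integrableOn_Ioo_of_le hx.le).1
      intervalIntegral.intervalIntegrable_log')
  have hlogt_eq : ∫ t in Ioo 0 x, log t = x * log x - x := by
    rw [← integral_Ioc_eq_integral_Ioo, ← intervalIntegral.integral_of_le hx.le, integral_log]
    simp
  have hlogf_eq : ∫ t in Ioo 0 x, log (f t) = x * A := by rw [hA]; field_simp
  have hconst : IntegrableOn (fun _ : ℝ => 1 - a) (Ioo 0 x) := by simp
  have hsum : IntegrableOn (fun t => log t + log (f t)) (Ioo 0 x) := hlogt.add hlog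
  have hle : ∫ t in Ioo 0 x, exp a * ((1 - a) + (log t + log (f t)))
      ≤ ∫ t in Ioo 0 x, t * f t := by
    refine setIntegral_mono_on ((hconst.add hsum).const_mul _) hint measurableSet_Ioo
      fun t ht => ?_
    have hft := hpos t ht
    calc exp a * ((1 - a) + (log t + log (f t)))
        ≤ exp a * exp (log t + log (f t) - a) := by
          gcongr
          linarith [add_one_le_exp (log t + log (f t) - a)]
      _ = t * f t := by
          rw [← exp_add, add_sub_cancel, exp_add, exp_log ht.1, exp_log hft]
  have heq : ∫ t in Ioo 0 x, exp a * ((1 - a) + (log t + log (f t))) = exp a * x := by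
    rw [integral_const_mul, integral_add hconst hsum, integral_add hlogt hlog, hlogt_eq, hlogf_eq]
    simp only [integral_const, measureReal_restrict_apply_univ, volume_real_Ioo_of_le hx.le,
      sub_zero, smul_eq_mul, ha]
    ring
  have hexp : exp A = exp 1 / x ^ 2 * (exp a * x) := by
    rw [ha, exp_sub, exp_add, exp_log hx]
    field_simp
  rw [hexp, ← heq]
  gcongr

/-- The tail integral `∫ₜ^∞ c / x² dx = c / t`. -/
lemma lintegral_Ioi_ofReal_div_sq {c t : ℝ} (hc : 0 ≤ c) (ht : 0 < t) :
    ∫⁻ x in Ioi t, ENNReal.ofReal (c / x ^ 2) = ENNReal.ofReal (c / t) := by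
  have hcongr : EqOn (fun x : ℝ => c * x ^ (-2 : ℝ)) (fun x => c / x ^ 2) (Ioi t) := by
    intro x hx
    have hx0 : 0 < x := ht.trans hx
    simp only [rpow_neg hx0.le, rpow_ofNat, div_eq_mul_inv]
  have hint : IntegrableOn (fun x : ℝ => c / x ^ 2) (Ioi t) :=
    IntegrableOn.congr_fun ((integrableOn_Ioi_rpow_of_lt (by norm_num) ht).const_mul c) hcongr
      measurableSet_Ioi
  rw [← ofReal_integral_eq_lintegral_ofReal hint (ae_of_all _ fun x => by positivity),
    ← setIntegral_congr_fun measurableSet_Ioi hcongr, integral_const_mul,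
    integral_Ioi_rpow_of_lt (by norm_num) ht]
  norm_num [rpow_neg ht.le, div_eq_mul_inv]

/-- Tonelli's theorem on the triangle `0 < t < x`. -/
lemma lintegral_Ioi_lintegral_Ioo_swap {F : ℝ → ℝ → ENNReal}
    (hF : Measurable (Function.uncurry F)) :
    ∫⁻ x in Ioi (0 : ℝ), ∫⁻ t in Ioo 0 x, F x t = ∫⁻ t in Ioi (0 : ℝ), ∫⁻ x in Ioi t, F x t := by
  have hS : MeasurableSet {p : ℝ × ℝ | 0 < p.2 ∧ p.2 < p.1} :=
    (measurableSet_lt measurable_const measurable_snd).inter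
      (measurableSet_lt measurable_snd measurable_fst)
  have hG := hF.indicator hS
  have hleft (x : ℝ) : (Ioi (0 : ℝ)).indicator (fun x => ∫⁻ t in Ioo 0 x, F x t) x
      = ∫⁻ t, {p : ℝ × ℝ | 0 < p.2 ∧ p.2 < p.1}.indicator (Function.uncurry F) (x, t) := by
    have h : ∫⁻ t in Ioo 0 x, F x t
        = ∫⁻ t, {p : ℝ × ℝ | 0 < p.2 ∧ p.2 < p.1}.indicator (Function.uncurry F) (x, t) := by
      rw [← lintegral_indicator measurableSet_Ioo]
      rfl
    by_cases hx : x ∈ Ioi 0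
    · rw [indicator_of_mem hx, h]
    · rw [indicator_of_notMem hx, ← h, Ioo_eq_empty hx]
      simp
  have hright (t : ℝ) : (Ioi (0 : ℝ)).indicator (fun t => ∫⁻ x in Ioi t, F x t) t
      = ∫⁻ x, {p : ℝ × ℝ | 0 < p.2 ∧ p.2 < p.1}.indicator (Function.uncurry F) (x, t) := by
    by_cases ht : t ∈ Ioi 0
    · rw [indicator_of_mem ht, ← lintegral_indicator measurableSet_Ioi]
      rw [mem_Ioi] at ht
      simp [indicator, ht]
    · rw [indicator_of_notMem ht]
      rw [mem_Ioi] at ht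
      simp [indicator, ht]
  rw [← lintegral_indicator measurableSet_Ioi, ← lintegral_indicator measurableSet_Ioi]
  simp_rw [hleft, hright]
  exact lintegral_lintegral_swap hG.aemeasurable

/-- Integral Carleman–Knopp inequality: the geometric integral mean has Hardy constant `e`. -/
theorem integral_carleman_knopp (f : ℝ → ℝ) (hmeas : Measurable f)
    (hint : IntegrableOn f (Set.Ioi 0))
    (hpos : ∀ x ∈ Set.Ioi (0:ℝ), 0 < f x)
    (hloc : ∀ x ∈ Set.Ioi (0:ℝ), IntegrableOn (fun t => Real.log (f t)) (Set.Ioo 0 x)) :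
    ∫ x in Set.Ioi (0:ℝ), Real.exp ((1/x) * ∫ t in Set.Ioo (0:ℝ) x, Real.log (f t))
      ≤ Real.exp 1 * ∫ x in Set.Ioi (0:ℝ), f x := by
  have hnonneg : 0 ≤ exp 1 * ∫ x in Ioi (0 : ℝ), f x :=
    mul_nonneg (exp_pos 1).le (setIntegral_nonneg measurableSet_Ioi fun x hx => (hpos x hx).le)
  have hmul (x : ℝ) : IntegrableOn (fun t => t * f t) (Ioo 0 x) := by
    refine Integrable.bdd_mul (c := x) (hint.mono_set Ioo_subset_Ioi_self)
      measurable_id.aestronglyMeasurable ?_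
    filter_upwards [ae_restrict_mem measurableSet_Ioo] with t ht
    simpa [abs_of_pos ht.1] using ht.2.le
  have hpoint : ∀ x ∈ Ioi (0 : ℝ), ‖exp ((1 / x) * ∫ t in Ioo 0 x, log (f t))‖ₑ
      ≤ ∫⁻ t in Ioo 0 x, ENNReal.ofReal (exp 1 * (t * f t) / x ^ 2) := by
    intro x hx
    have hfx : ∀ t ∈ Ioo 0 x, 0 < f t := fun t ht => hpos t ht.1
    rw [enorm_of_nonneg (exp_pos _).le, ← ofReal_integral_eq_lintegral_ofReal
      (((hmul x).const_mul _).div_const _)]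
    · refine ENNReal.ofReal_le_ofReal
        ((exp_average_log_le hx hfx (hmul x) (hloc x hx)).trans_eq ?_)
      rw [integral_div, integral_const_mul]
      ring
    · filter_upwards [ae_restrict_mem measurableSet_Ioo] with t ht
      have := hfx t ht
      have := ht.1
      simp only [Pi.zero_apply]
      positivity
  rw [← ENNReal.ofReal_le_ofReal_iff hnonneg]
  calc ENNReal.ofReal (∫ x in Ioi (0 : ℝ), exp ((1 / x) * ∫ t in Ioo 0 x, log (f t)))
      ≤ ‖∫ x in Ioi (0 : ℝ), exp ((1 / x) * ∫ t in Ioo 0 x, log (f t))‖ₑ :=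
        ofReal_le_enorm _
    _ ≤ ∫⁻ x in Ioi (0 : ℝ), ‖exp ((1 / x) * ∫ t in Ioo 0 x, log (f t))‖ₑ :=
        enorm_integral_le_lintegral_enorm _
    _ ≤ ∫⁻ x in Ioi (0 : ℝ), ∫⁻ t in Ioo 0 x, ENNReal.ofReal (exp 1 * (t * f t) / x ^ 2) :=
        setLIntegral_mono' measurableSet_Ioi hpoint
    _ = ∫⁻ t in Ioi (0 : ℝ), ∫⁻ x in Ioi t, ENNReal.ofReal (exp 1 * (t * f t) / x ^ 2) :=
        lintegral_Ioi_lintegral_Ioo_swap (by unfold Function.uncurry; fun_prop)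
    _ = ∫⁻ t in Ioi (0 : ℝ), ENNReal.ofReal (exp 1 * f t) := by
        refine setLIntegral_congr_fun measurableSet_Ioi fun t ht => ?_
        have ht0 : 0 < t := ht
        have hft := hpos t ht
        rw [lintegral_Ioi_ofReal_div_sq (by positivity) ht0]
        congr 1
        field_simp
    _ = ENNReal.ofReal (exp 1 * ∫ x in Ioi (0 : ℝ), f x) := by
        rw [← integral_const_mul, ofReal_integral_eq_lintegral_ofReal (hint.const_mul _)]
        filter_upwards [ae_restrict_mem measurableSet_Ioi] with t ht
        exact mul_nonneg (exp_pos 1).le (hpos t ht).le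
end

section
/- For every p ∈ (−∞,0)∪(0,1) and every real C < (1−p)^{−1/p} there exists a Lebesgue measurable integrable function f : (0,∞) → (0,∞) with 0 < ∫₀^∞ f < ∞ and with f^p integrable on (0,x) for every x > 0, such that ∫₀^∞ ((1/x)∫₀^x f(t)^p dt)^{1/p} dx > C ∫₀^∞ f(x) dx. -/
open MeasureTheory Set Real

lemma measurable_ite_rpow (c d u v : ℝ) :
    Measurable fun t : ℝ => if t ≤ 1 then c * t ^ u else d * t ^ v :=
  Measurable.ite measurableSet_Iic (by fun_prop) (by fun_prop)

lemma integrableOn_and_integral_ite_rpow (c d : ℝ) {ε : ℝ} (hε : 0 < ε) :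
    IntegrableOn (fun t : ℝ => if t ≤ 1 then c * t ^ (ε - 1) else d * t ^ (-1 - ε)) (Ioi 0) ∧
      ∫ t in Ioi (0:ℝ), (if t ≤ 1 then c * t ^ (ε - 1) else d * t ^ (-1 - ε)) = (c + d) / ε := by
  have e₁ : EqOn (fun t : ℝ => if t ≤ 1 then c * t ^ (ε - 1) else d * t ^ (-1 - ε))
      (fun t => c * t ^ (ε - 1)) (Ioc 0 1) := fun t ht => if_pos ht.2
  have e₂ : EqOn (fun t : ℝ => if t ≤ 1 then c * t ^ (ε - 1) else d * t ^ (-1 - ε))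
      (fun t => d * t ^ (-1 - ε)) (Ioi 1) := fun t ht => if_neg (not_le.2 ht)
  have i₁ : IntegrableOn (fun t : ℝ => c * t ^ (ε - 1)) (Ioc 0 1) :=
    ((intervalIntegrable_iff_integrableOn_Ioc_of_le zero_le_one).1
      (intervalIntegral.intervalIntegrable_rpow' (by linarith))).const_mul c
  have i₂ : IntegrableOn (fun t : ℝ => d * t ^ (-1 - ε)) (Ioi 1) :=
    (integrableOn_Ioi_rpow_of_lt (by linarith) one_pos).const_mul d
  have j₁ := i₁.congr_fun e₁.symm measurableSet_Ioc
  have j₂ := i₂.congr_fun e₂.symm measurableSet_Ioi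
  rw [← Ioc_union_Ioi_eq_Ioi (zero_le_one' ℝ)]
  refine ⟨j₁.union j₂, ?_⟩
  rw [setIntegral_union (Ioc_disjoint_Ioi le_rfl) measurableSet_Ioi j₁ j₂,
    setIntegral_congr_fun measurableSet_Ioc e₁, setIntegral_congr_fun measurableSet_Ioi e₂,
    integral_const_mul, integral_const_mul, integral_Ioi_rpow_of_lt (by linarith) one_pos,
    ← intervalIntegral.integral_of_le zero_le_one, integral_rpow (Or.inl (by linarith))]
  have h : -1 - ε + 1 = -ε := by ring
  rw [sub_add_cancel, h, one_rpow, one_rpow, zero_rpow hε.ne']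
  field_simp
  ring

lemma integrableOn_and_integral_Ioo_ite_rpow {a b x : ℝ} (ha : 0 < a) (hb : 0 < b) (hx : 0 < x) :
    IntegrableOn (fun t : ℝ => if t ≤ 1 then a * t ^ (a - 1) else b * t ^ (b - 1)) (Ioo 0 x) ∧
      ∫ t in Ioo (0:ℝ) x, (if t ≤ 1 then a * t ^ (a - 1) else b * t ^ (b - 1)) =
        if x ≤ 1 then x ^ a else x ^ b := by
  have key : ∀ {e y z : ℝ}, 0 < e → y ≤ z → IntegrableOn (fun t : ℝ => e * t ^ (e - 1)) (Ioc y z) ∧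
      ∫ t in Ioc y z, e * t ^ (e - 1) = z ^ e - y ^ e := by
    intro e y z he hyz
    refine ⟨((intervalIntegrable_iff_integrableOn_Ioc_of_le hyz).1
      (intervalIntegral.intervalIntegrable_rpow' (by linarith))).const_mul e, ?_⟩
    rw [integral_const_mul, ← intervalIntegral.integral_of_le hyz,
      integral_rpow (Or.inl (by linarith)), sub_add_cancel]
    field_simp
  rw [← integrableOn_Ioc_iff_integrableOn_Ioo, ← integral_Ioc_eq_integral_Ioo]
  have e₁ : ∀ {y : ℝ}, y ≤ 1 → EqOn (fun t : ℝ => if t ≤ 1 then a * t ^ (a - 1) else b * t ^ (b - 1))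
      (fun t => a * t ^ (a - 1)) (Ioc 0 y) := fun hy t ht => if_pos (ht.2.trans hy)
  have e₂ : EqOn (fun t : ℝ => if t ≤ 1 then a * t ^ (a - 1) else b * t ^ (b - 1))
      (fun t => b * t ^ (b - 1)) (Ioc 1 x) := fun t ht => if_neg (not_le.2 ht.1)
  rcases le_or_gt x 1 with h | h
  · obtain ⟨i, v⟩ := key ha hx.le
    refine ⟨i.congr_fun (e₁ h).symm measurableSet_Ioc, ?_⟩
    rw [setIntegral_congr_fun measurableSet_Ioc (e₁ h), v, if_pos h, zero_rpow ha.ne', sub_zero]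
  · obtain ⟨i₁, v₁⟩ := key ha zero_le_one
    obtain ⟨i₂, v₂⟩ := key hb h.le
    have j₁ := i₁.congr_fun (e₁ le_rfl).symm measurableSet_Ioc
    have j₂ := i₂.congr_fun e₂.symm measurableSet_Ioc
    rw [← Ioc_union_Ioc_eq_Ioc zero_le_one h.le]
    refine ⟨j₁.union j₂, ?_⟩
    rw [setIntegral_union (Ioc_disjoint_Ioc_of_le le_rfl) measurableSet_Ioc j₁ j₂,
      setIntegral_congr_fun measurableSet_Ioc (e₁ le_rfl),
      setIntegral_congr_fun measurableSet_Ioc e₂, v₁, v₂, if_neg (not_le.2 h),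
      zero_rpow ha.ne', one_rpow, one_rpow]
    ring

open Filter Topology in
lemma exists_pos_mul_add_rpow_lt_two {p C : ℝ} (hp : p < 1)
    (hC : C < (1 - p) ^ (-(1/p))) :
    ∃ ε > 0, 0 < 1 - p + p * ε ∧ 0 < 1 - p - p * ε ∧
      C * ((1 - p + p * ε) ^ (1/p) + (1 - p - p * ε) ^ (1/p)) < 2 := by
  have h1p : 0 < 1 - p := by linarith
  have h₁ : ContinuousAt (fun ε : ℝ => 1 - p + p * ε) 0 := by fun_prop
  have h₂ : ContinuousAt (fun ε : ℝ => 1 - p - p * ε) 0 := by fun_prop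
  have h₃ : ContinuousAt (fun ε : ℝ =>
      C * ((1 - p + p * ε) ^ (1/p) + (1 - p - p * ε) ^ (1/p))) 0 :=
    continuousAt_const.mul ((h₁.rpow_const (Or.inl (by simpa using h1p.ne'))).add
      (h₂.rpow_const (Or.inl (by simpa using h1p.ne'))))
  have hlim : C * (1 - p) ^ (1/p) < 1 := by
    rwa [rpow_neg h1p.le, ← one_div, lt_div_iff₀ (rpow_pos_of_pos h1p _)] at hC
  have ev : ∀ᶠ ε in 𝓝 (0:ℝ), 0 < 1 - p + p * ε ∧ 0 < 1 - p - p * ε ∧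
      C * ((1 - p + p * ε) ^ (1/p) + (1 - p - p * ε) ^ (1/p)) < 2 :=
    (h₁.eventually_const_lt (by simpa using hp)).and
      ((h₂.eventually_const_lt (by simpa using hp)).and
        (h₃.eventually_lt_const (by simp only [mul_zero, add_zero, sub_zero]; linarith)))
  obtain ⟨ε, h, hε⟩ :=
    ((ev.filter_mono nhdsWithin_le_nhds).and (self_mem_nhdsWithin (s := Ioi (0:ℝ)))).exists
  exact ⟨ε, hε, h⟩

/-- Sharpness of the constant `(1-p)^(-1/p)` in the integral Hardy inequality
for power means, for `p ∈ (-∞,0) ∪ (0,1)`. -/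
theorem integral_hardy_power_mean_sharp (p : ℝ) (hp : p < 0 ∨ p ∈ Set.Ioo (0:ℝ) 1)
    (C : ℝ) (hC : C < (1 - p) ^ (-(1/p))) :
    ∃ f : ℝ → ℝ, Measurable f ∧ IntegrableOn f (Set.Ioi 0) ∧
      (∀ x ∈ Set.Ioi (0:ℝ), 0 < f x) ∧
      (0 < ∫ x in Set.Ioi (0:ℝ), f x) ∧
      (∀ x ∈ Set.Ioi (0:ℝ), IntegrableOn (fun t => f t ^ p) (Set.Ioo 0 x)) ∧
      C * ∫ x in Set.Ioi (0:ℝ), f x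
        < ∫ x in Set.Ioi (0:ℝ), ((1/x) * ∫ t in Set.Ioo (0:ℝ) x, f t ^ p) ^ (1/p) := by
  have hp0 : p ≠ 0 := hp.elim ne_of_lt fun h => h.1.ne'
  have hp1 : p < 1 := hp.elim (fun h => h.trans one_pos) fun h => h.2
  obtain ⟨ε, hε, hA, hB, hlt⟩ := exists_pos_mul_add_rpow_lt_two hp1 hC
  set A := 1 - p + p * ε with hAdef
  set B := 1 - p - p * ε with hBdef
  have hA' : 0 < A ^ (1/p) := rpow_pos_of_pos hA _
  have hB' : 0 < B ^ (1/p) := rpow_pos_of_pos hB _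
  obtain ⟨hint, hval⟩ := integrableOn_and_integral_ite_rpow (A ^ (1/p)) (B ^ (1/p)) hε
  have rpow_p : ∀ {a u t : ℝ}, 0 < a → 0 < t → (a ^ (1/p) * t ^ u) ^ p = a * t ^ (u * p) := by
    intro a u t ha ht
    rw [mul_rpow (by positivity) (by positivity), ← rpow_mul ha.le, ← rpow_mul ht.le,
      one_div_mul_cancel hp0, rpow_one]
  have hpow : ∀ x : ℝ, EqOn (fun t : ℝ => if t ≤ 1 then A * t ^ (A - 1) else B * t ^ (B - 1))
      (fun t => (if t ≤ 1 then A ^ (1/p) * t ^ (ε - 1) else B ^ (1/p) * t ^ (-1 - ε)) ^ p)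
      (Ioo 0 x) := by
    intro x t ht
    dsimp only
    split_ifs
    · rw [rpow_p hA ht.1, hAdef]; ring_nf
    · rw [rpow_p hB ht.1, hBdef]; ring_nf
  have rpow_mean : ∀ {a u x : ℝ}, 0 < x → a - 1 = u * p → (1 / x * x ^ a) ^ (1/p) = x ^ u := by
    intro a u x hx h
    rw [one_div_mul_eq_div, ← rpow_sub_one hx.ne', h, ← rpow_mul hx.le, mul_assoc,
      mul_one_div_cancel hp0, mul_one]
  refine ⟨_, measurable_ite_rpow _ _ _ _, hint, fun x hx => ?_, by rw [hval]; positivity,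
    fun x hx => (integrableOn_and_integral_Ioo_ite_rpow hA hB hx).1.congr_fun (hpow x)
      measurableSet_Ioo, ?_⟩
  · have hx : 0 < x := hx
    split_ifs <;> positivity
  have hmean : EqOn (fun x : ℝ => ((1/x) * ∫ t in Ioo (0:ℝ) x,
      (if t ≤ 1 then A ^ (1/p) * t ^ (ε - 1) else B ^ (1/p) * t ^ (-1 - ε)) ^ p) ^ (1/p))
      (fun x => if x ≤ 1 then 1 * x ^ (ε - 1) else 1 * x ^ (-1 - ε)) (Ioi 0) := by
    intro x hx
    dsimp only
    rw [← setIntegral_congr_fun measurableSet_Ioo (hpow x),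
      (integrableOn_and_integral_Ioo_ite_rpow hA hB hx).2]
    split_ifs
    · rw [rpow_mean (u := ε - 1) hx (by rw [hAdef]; ring), one_mul]
    · rw [rpow_mean (u := -1 - ε) hx (by rw [hBdef]; ring), one_mul]
  rw [setIntegral_congr_fun measurableSet_Ioi hmean,
    (integrableOn_and_integral_ite_rpow 1 1 hε).2, hval, ← mul_div_assoc]
  gcongr
  linarith
end

section
/- For every real C < e there exists a Lebesgue measurable integrable function f : (0,∞) → (0,∞) with 0 < ∫₀^∞ f < ∞ and with t ↦ ln f(t) integrable on (0,x) for every x > 0, such that ∫₀^∞ exp((1/x)∫₀^x ln f(t) dt) dx > C ∫₀^∞ f(x) dx. -/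
open MeasureTheory Set Real

/-- Termwise logarithm of the Gamma density `t ^ (s - 1) * exp (-t)`. -/
lemma log_rpow_mul_exp_neg {s t : ℝ} (ht : 0 < t) :
    Real.log (t ^ (s - 1) * Real.exp (-t)) = (s - 1) * Real.log t - t := by
  rw [Real.log_mul (rpow_pos_of_pos ht _).ne' (exp_pos _).ne', Real.log_rpow ht, Real.log_exp]
  ring

lemma integrableOn_log_rpow_mul_exp_neg (s : ℝ) {x : ℝ} (hx : 0 < x) :
    IntegrableOn (fun t => Real.log (t ^ (s - 1) * Real.exp (-t))) (Ioo 0 x) := by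
  have h : IntervalIntegrable (fun t : ℝ => (s - 1) * Real.log t - t) volume 0 x :=
    (intervalIntegral.intervalIntegrable_log'.const_mul _).sub intervalIntegral.intervalIntegrable_id
  rw [intervalIntegrable_iff_integrableOn_Ioo_of_le hx.le] at h
  exact h.congr_fun (fun t ht => (log_rpow_mul_exp_neg ht.1).symm) measurableSet_Ioo

/-- The geometric mean over `(0, x)` of the Gamma density `t ^ (s - 1) * exp (-t)`. -/
lemma exp_average_log_rpow_mul_exp_neg (s : ℝ) {x : ℝ} (hx : 0 < x) :
    Real.exp ((1 / x) * ∫ t in Ioo 0 x, Real.log (t ^ (s - 1) * Real.exp (-t))) =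
      Real.exp (1 - s) * (x ^ (s - 1) * Real.exp (-(1 / 2 * x))) := by
  have h : ∫ t in Ioo 0 x, Real.log (t ^ (s - 1) * Real.exp (-t)) =
      (s - 1) * (x * Real.log x - x) - x ^ 2 / 2 := by
    rw [setIntegral_congr_fun measurableSet_Ioo fun t ht => log_rpow_mul_exp_neg ht.1,
      ← integral_Ioc_eq_integral_Ioo, ← intervalIntegral.integral_of_le hx.le,
      intervalIntegral.integral_sub (intervalIntegral.intervalIntegrable_log'.const_mul _)
        intervalIntegral.intervalIntegrable_id,
      intervalIntegral.integral_const_mul, integral_log, integral_id]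
    simp
  rw [h, rpow_def_of_pos hx, ← Real.exp_add, ← Real.exp_add]
  congr 1
  field_simp
  ring

/-- Sharpness of the constant `e` in the integral Carleman–Knopp inequality. -/
theorem integral_carleman_knopp_sharp (C : ℝ) (hC : C < Real.exp 1) :
    ∃ f : ℝ → ℝ, Measurable f ∧ IntegrableOn f (Set.Ioi 0) ∧
      (∀ x ∈ Set.Ioi (0:ℝ), 0 < f x) ∧
      (0 < ∫ x in Set.Ioi (0:ℝ), f x) ∧
      (∀ x ∈ Set.Ioi (0:ℝ), IntegrableOn (fun t => Real.log (f t)) (Set.Ioo 0 x)) ∧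
      C * ∫ x in Set.Ioi (0:ℝ), f x
        < ∫ x in Set.Ioi (0:ℝ), Real.exp ((1/x) * ∫ t in Set.Ioo (0:ℝ) x, Real.log (f t)) := by
  obtain ⟨D, hD, hDe⟩ := exists_between (max_lt hC (exp_pos 1))
  obtain ⟨hCD, hD0⟩ := max_lt_iff.1 hD
  obtain ⟨s, hs, hsD⟩ : ∃ s : ℝ, 0 < s ∧ Real.exp (1 - s) = D :=
    ⟨1 - Real.log D, sub_pos.2 ((Real.log_lt_iff_lt_exp hD0).2 hDe), by
      rw [sub_sub_cancel, Real.exp_log hD0]⟩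
  have hint : ∫ x in Ioi (0 : ℝ), x ^ (s - 1) * Real.exp (-x) = Real.Gamma s := by
    simpa using Real.integral_rpow_mul_exp_neg_mul_Ioi hs one_pos
  have hΓ := Real.Gamma_pos_of_pos hs
  refine ⟨fun t => t ^ (s - 1) * Real.exp (-t), by fun_prop, ?_, ?_, ?_, ?_, ?_⟩
  · simpa only [mul_comm] using Real.GammaIntegral_convergent hs
  · exact fun x hx => mul_pos (rpow_pos_of_pos hx _) (exp_pos _)
  · rwa [hint]
  · exact fun x hx => integrableOn_log_rpow_mul_exp_neg s hx
  · rw [hint, setIntegral_congr_fun measurableSet_Ioi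
      fun x hx => exp_average_log_rpow_mul_exp_neg s hx, integral_const_mul,
      Real.integral_rpow_mul_exp_neg_mul_Ioi hs one_half_pos, hsD, one_div_one_div]
    have h2 : 1 ≤ (2 : ℝ) ^ s := one_le_rpow one_le_two hs.le
    calc C * Real.Gamma s < D * Real.Gamma s := by gcongr
      _ ≤ D * (2 ^ s * Real.Gamma s) := by
        gcongr
        exact le_mul_of_one_le_left hΓ.le h2
end

section
/- Let p ≠ q be real numbers with min(p,q) ≤ 0 ≤ max(p,q) < 1. Then for every Lebesgue measurable integrable function f : (0,∞) → (0,∞) such that for every t > 0 the integrals ∫₀^t f(s)^p ds and ∫₀^t f(s)^q ds are finite, one has ∫₀^∞ (∫₀^t f(s)^p ds / ∫₀^t f(s)^q ds)^{1/(p−q)} dt ≤ ((1−q)/(1−p))^{1/(p−q)} ∫₀^∞ f(t) dt. -/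
open MeasureTheory Set Real

/-- The tangent-line bound `(v ^ p - v ^ q) / (p - q) ≤ v - 1` at `v = C * u / y`, in homogeneous
form. -/
theorem add_rpow_sub_rpow_div_le {p q : ℝ} (hqp : q < p) (hq0 : q ≤ 0) (hp0 : 0 ≤ p) (hp1 : p < 1)
    {u y C : ℝ} (hu : 0 < u) (hy : 0 < y) (hC : 0 < C) :
    y + (y ^ (1 - p) * C ^ p * u ^ p - y ^ (1 - q) * C ^ q * u ^ q) / (p - q) ≤ C * u := by
  have hv : 0 < C * u / y := by positivity
  have hvp : (C * u / y) ^ p ≤ 1 + p * (C * u / y - 1) := by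
    have := rpow_one_add_le_one_add_mul_self (s := C * u / y - 1) (by linarith) hp0 hp1.le
    rwa [add_sub_cancel] at this
  have hvq : 1 + q * (C * u / y - 1) ≤ (C * u / y) ^ q := by
    rw [Real.rpow_def_of_pos hv]
    nlinarith [Real.add_one_le_exp (Real.log (C * u / y) * q), Real.log_le_sub_one_of_pos hv]
  have homog : ∀ r : ℝ, y ^ (1 - r) * C ^ r * u ^ r = y * (C * u / y) ^ r := fun r => by
    rw [Real.div_rpow (by positivity) hy.le, Real.mul_rpow hC.le hu.le, Real.rpow_sub hy,
      Real.rpow_one]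
    ring
  have hdiv : ((C * u / y) ^ p - (C * u / y) ^ q) / (p - q) ≤ C * u / y - 1 := by
    rw [div_le_iff₀ (by linarith)]
    linarith
  calc _ = y * (1 + ((C * u / y) ^ p - (C * u / y) ^ q) / (p - q)) := by
        rw [homog, homog]; ring
    _ ≤ y * (C * u / y) := by gcongr; linarith
    _ = C * u := by field_simp

/-- Weighted Young inequality with the exponents `p - q ≤ 1 - q`. -/
theorem rpow_mul_rpow_sub_le {p q : ℝ} (hqp : q < p) (hp1 : p < 1)
    {x y : ℝ} (hx : 0 ≤ x) (hy : 0 < y) :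
    (1 - q) * (y ^ (1 - p) * x ^ (p - q)) - (1 - p) * y ^ (1 - q) ≤ (p - q) * x ^ (1 - q) := by
  have hq1 : 0 < 1 - q := by linarith
  have hw : 0 ≤ x / y := by positivity
  have key : (x / y) ^ (p - q) ≤ 1 + (p - q) / (1 - q) * ((x / y) ^ (1 - q) - 1) := by
    have := rpow_one_add_le_one_add_mul_self (s := (x / y) ^ (1 - q) - 1)
      (p := (p - q) / (1 - q)) (by linarith [Real.rpow_nonneg hw (1 - q)])
      (div_nonneg (by linarith) hq1.le) (by rw [div_le_one hq1]; linarith)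
    rwa [add_sub_cancel, ← Real.rpow_mul hw, mul_div_cancel₀ _ hq1.ne'] at this
  have key' : (1 - q) * (x / y) ^ (p - q) ≤ (1 - p) + (p - q) * (x / y) ^ (1 - q) := by
    calc _ ≤ (1 - q) * (1 + (p - q) / (1 - q) * ((x / y) ^ (1 - q) - 1)) := by gcongr
      _ = _ := by field_simp; ring
  have hyq := Real.rpow_pos_of_pos hy (1 - q)
  have h1 : y ^ (1 - p) * x ^ (p - q) = y ^ (1 - q) * (x / y) ^ (p - q) := by
    rw [Real.div_rpow hx hy.le, show 1 - q = (1 - p) + (p - q) by ring, Real.rpow_add hy]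
    have := Real.rpow_pos_of_pos hy (p - q)
    field_simp
  have h2 : x ^ (1 - q) = y ^ (1 - q) * (x / y) ^ (1 - q) := by
    rw [Real.div_rpow hx hy.le]
    field_simp
  rw [h1, h2]
  nlinarith [mul_le_mul_of_nonneg_left key' hyq.le]

/-- If the increments of `Ψ` dominate `(t - s) * G t` and `G` is continuous, then they dominate the
integral of `G`. -/
theorem integral_le_sub_of_mul_le_sub {Ψ G : ℝ → ℝ} {a b : ℝ} (hab : a ≤ b)
    (hΨ : ContinuousOn Ψ (Icc a b)) (hG : ContinuousOn G (Ici a))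
    (h : ∀ s t, a ≤ s → s < t → (t - s) * G t ≤ Ψ t - Ψ s) :
    ∫ t in a..b, G t ≤ Ψ b - Ψ a := by
  have hGi : ∀ x, a ≤ x → IntervalIntegrable G volume a x := fun x hx =>
    (hG.mono (by rw [uIcc_of_le hx]; exact Icc_subset_Ici_self)).intervalIntegrable
  have main := image_le_of_liminf_slope_right_le_deriv_boundary (f := fun x => -Ψ x)
    (a := a) (b := b) hΨ.neg (B := fun x => -Ψ a - ∫ t in a..x, G t) (B' := fun x => -G x)
    (by simp)
    (by
      refine continuousOn_const.sub ?_
      have := intervalIntegral.continuousOn_primitive_interval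
        (f := G) (a := a) (b := b) (μ := volume)
        (by
          rw [uIcc_of_le hab]
          exact (intervalIntegrable_iff_integrableOn_Icc_of_le hab).1 (hGi b hab))
      rwa [uIcc_of_le hab] at this)
    (fun x hx => by
      have := intervalIntegral.integral_hasDerivWithinAt_right (s := Ici x) (t := Ioi x)
        (hGi x hx.1)
        ((hG.mono (Ioi_subset_Ici hx.1)).stronglyMeasurableAtFilter_nhdsWithin measurableSet_Ioi x)
        ((hG x hx.1).mono (Ioi_subset_Ici hx.1))
      exact this.const_sub _)
    (fun x hx r hr => by
      have hlim : Filter.Tendsto (fun z => -G z) (nhdsWithin x (Ioi x)) (nhds (-G x)) :=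
        ((hG x hx.1).mono (Ioi_subset_Ici hx.1)).neg
      refine Filter.Eventually.frequently ?_
      filter_upwards [hlim.eventually (gt_mem_nhds hr), self_mem_nhdsWithin] with z hz hxz
      have hxz' : x < z := hxz
      refine lt_of_le_of_lt ?_ hz
      rw [slope_def_field, div_le_iff₀ (by linarith)]
      linarith [h x z hx.1 hxz'])
    (right_mem_Icc.2 hab)
  linarith

/-- The integral Hardy inequality for Gini means when `q ≤ 0 ≤ p < 1` and `q < p`. -/
theorem integral_gini_le_of_lt {p q : ℝ} (hqp : q < p) (hq0 : q ≤ 0) (hp0 : 0 ≤ p) (hp1 : p < 1)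
    {f : ℝ → ℝ} (hint : IntegrableOn f (Ioi 0)) (hpos : ∀ t ∈ Ioi (0 : ℝ), 0 < f t)
    (hp : ∀ t ∈ Ioi (0 : ℝ), IntegrableOn (fun s => f s ^ p) (Ioo 0 t))
    (hq : ∀ t ∈ Ioi (0 : ℝ), IntegrableOn (fun s => f s ^ q) (Ioo 0 t)) :
    ∫ t in Ioi (0 : ℝ),
        ((∫ s in Ioo (0 : ℝ) t, f s ^ p) / (∫ s in Ioo (0 : ℝ) t, f s ^ q)) ^ (1 / (p - q))
      ≤ ((1 - q) / (1 - p)) ^ (1 / (p - q)) * ∫ t in Ioi (0 : ℝ), f t := by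
  have hpq : 0 < p - q := by linarith
  have hp1' : 0 < 1 - p := by linarith
  have hq1' : 0 < 1 - q := by linarith
  set C : ℝ := ((1 - q) / (1 - p)) ^ (1 / (p - q)) with hCdef
  have hC : 0 < C := by positivity
  have hCpq : C ^ p * (1 - p) = C ^ q * (1 - q) := by
    have h1 : C ^ (p - q) = (1 - q) / (1 - p) := by
      rw [hCdef, ← Real.rpow_mul (by positivity), one_div_mul_cancel hpq.ne', Real.rpow_one]
    rw [show p = (p - q) + q by ring, Real.rpow_add hC, h1, ← show p = (p - q) + q by ring]
    field_simp
  set A : ℝ → ℝ := fun t => ∫ s in (0 : ℝ)..t, f s ^ p with hA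
  set B : ℝ → ℝ := fun t => ∫ s in (0 : ℝ)..t, f s ^ q with hB
  set F : ℝ → ℝ := fun t => ∫ s in (0 : ℝ)..t, f s with hF
  set G : ℝ → ℝ := fun t => (A t / B t) ^ (1 / (p - q)) with hG
  set Φ : ℝ → ℝ := fun t => C ^ q / (1 - p) * (B t * G t ^ (1 - q)) with hΦ
  have intF : ∀ t, 0 ≤ t → IntervalIntegrable f volume 0 t := fun t ht =>
    (intervalIntegrable_iff_integrableOn_Ioo_of_le ht).2 (hint.mono_set Ioo_subset_Ioi_self)
  have int_of : ∀ r : ℝ, (∀ t ∈ Ioi (0 : ℝ), IntegrableOn (fun s => f s ^ r) (Ioo 0 t)) →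
      ∀ t, 0 ≤ t → IntervalIntegrable (fun s => f s ^ r) volume 0 t := fun r hr t ht => by
    rw [intervalIntegrable_iff_integrableOn_Ioo_of_le ht]
    exact (hr (t + 1) (by simp only [mem_Ioi]; linarith)).mono_set
      (Ioo_subset_Ioo_right (by linarith))
  have intA := int_of p hp
  have intB := int_of q hq
  have pos_of : ∀ r : ℝ, (∀ t, 0 ≤ t → IntervalIntegrable (fun s => f s ^ r) volume 0 t) →
      ∀ t, 0 < t → 0 < ∫ s in (0 : ℝ)..t, f s ^ r := fun r hr t ht =>
    intervalIntegral.intervalIntegral_pos_of_pos_on (hr t ht.le)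
      (fun x hx => Real.rpow_pos_of_pos (hpos x hx.1) r) ht
  have posA : ∀ t, 0 < t → 0 < A t := pos_of p intA
  have posB : ∀ t, 0 < t → 0 < B t := pos_of q intB
  have posG : ∀ t, 0 < t → 0 < G t := fun t ht =>
    Real.rpow_pos_of_pos (div_pos (posA t ht) (posB t ht)) _
  have A0 : A 0 = 0 := by simp [hA]
  have B0 : B 0 = 0 := by simp [hB]
  have G0 : G 0 = 0 := by
    simp only [hG, A0, B0, div_zero]
    exact Real.zero_rpow (by positivity)
  have nonnegB : ∀ t, 0 ≤ t → 0 ≤ B t := fun t ht => by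
    rcases ht.eq_or_lt with rfl | h
    · exact B0.ge
    · exact (posB t h).le
  have nonnegG : ∀ t, 0 ≤ t → 0 ≤ G t := fun t ht => by
    rcases ht.eq_or_lt with rfl | h
    · exact G0.ge
    · exact (posG t h).le
  have A_eq : ∀ t, 0 ≤ t → A t = B t * G t ^ (p - q) := fun t ht => by
    rcases ht.eq_or_lt with rfl | h
    · simp [A0, B0]
    · have := posB t h
      rw [hG]
      simp only
      rw [← Real.rpow_mul (div_pos (posA t h) this).le, one_div_mul_cancel hpq.ne', Real.rpow_one]
      field_simp
  have incr : ∀ s t, 0 ≤ s → s < t → (t - s) * G t ≤ (C * F t - Φ t) - (C * F s - Φ s) := by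
    intro s t hs hst
    have ht : 0 < t := hs.trans_lt hst
    have hy := posG t ht
    set y := G t with hydef
    have iA : IntervalIntegrable (fun r => f r ^ p) volume s t :=
      (intA s hs).symm.trans (intA t ht.le)
    have iB : IntervalIntegrable (fun r => f r ^ q) volume s t :=
      (intB s hs).symm.trans (intB t ht.le)
    have iF : IntervalIntegrable f volume s t :=
      (intF s hs).symm.trans (intF t ht.le)
    have hmono : ∫ r in s..t, (y + (y ^ (1 - p) * C ^ p * f r ^ p
        - y ^ (1 - q) * C ^ q * f r ^ q) / (p - q)) ≤ ∫ r in s..t, C * f r := by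
      refine intervalIntegral.integral_mono_on_of_le_Ioo hst.le ?_ (iF.const_mul C) ?_
      · exact intervalIntegrable_const.add
          (((iA.const_mul _).sub (iB.const_mul _)).div_const _)
      · intro r hr
        exact add_rpow_sub_rpow_div_le hqp hq0 hp0 hp1 (hpos r (hs.trans_lt hr.1)) hy hC
    rw [intervalIntegral.integral_add intervalIntegrable_const
        (((iA.const_mul _).sub (iB.const_mul _)).div_const _),
      intervalIntegral.integral_div,
      intervalIntegral.integral_sub (iA.const_mul _) (iB.const_mul _),
      intervalIntegral.integral_const_mul, intervalIntegral.integral_const_mul,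
      intervalIntegral.integral_const_mul, intervalIntegral.integral_const, smul_eq_mul,
      ← intervalIntegral.integral_interval_sub_left (intA t ht.le) (intA s hs),
      ← intervalIntegral.integral_interval_sub_left (intB t ht.le) (intB s hs),
      ← intervalIntegral.integral_interval_sub_left (intF t ht.le) (intF s hs)] at hmono
    change (t - s) * y + (y ^ (1 - p) * C ^ p * (A t - A s) - y ^ (1 - q) * C ^ q * (B t - B s))
      / (p - q) ≤ C * (F t - F s) at hmono
    have hCp : C ^ p = C ^ q / (1 - p) * (1 - q) := by field_simp; linarith
    have hCq : C ^ q = C ^ q / (1 - p) * (1 - p) := by field_simp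
    have hyy : y ^ (1 - p) * y ^ (p - q) = y ^ (1 - q) := by
      rw [← Real.rpow_add hy]; congr 1; ring
    have hΦt : (y ^ (1 - p) * C ^ p * A t - y ^ (1 - q) * C ^ q * B t) / (p - q) = Φ t := by
      rw [A_eq t ht.le, hCp, hΦ]
      simp only
      rw [← hydef, ← hyy]
      field_simp
      ring
    have hΦs : (y ^ (1 - p) * C ^ p * A s - y ^ (1 - q) * C ^ q * B s) / (p - q) ≤ Φ s := by
      rw [A_eq s hs, hCp, div_le_iff₀ hpq, hΦ]
      have hy2 := rpow_mul_rpow_sub_le hqp hp1 (nonnegG s hs) hy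
      have hK : 0 ≤ C ^ q / (1 - p) * B s := mul_nonneg (by positivity) (nonnegB s hs)
      have := mul_le_mul_of_nonneg_left hy2 hK
      calc _ = C ^ q / (1 - p) * B s *
            ((1 - q) * (y ^ (1 - p) * G s ^ (p - q)) - (1 - p) * y ^ (1 - q)) := by
            field_simp
        _ ≤ _ := this
        _ = _ := by ring
    have split : (y ^ (1 - p) * C ^ p * (A t - A s) - y ^ (1 - q) * C ^ q * (B t - B s)) / (p - q)
        = (y ^ (1 - p) * C ^ p * A t - y ^ (1 - q) * C ^ q * B t) / (p - q)
        - (y ^ (1 - p) * C ^ p * A s - y ^ (1 - q) * C ^ q * B s) / (p - q) := by ring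
    linarith
  have cont_of : ∀ g : ℝ → ℝ, (∀ t, 0 ≤ t → IntervalIntegrable g volume 0 t) →
      ∀ t, 0 < t → ContinuousAt (fun t => ∫ s in (0 : ℝ)..t, g s) t := fun g hg t ht => by
    have h1 := intervalIntegral.continuousOn_primitive_interval
        (f := g) (a := 0) (b := t + 1) (μ := volume)
        (by
          rw [uIcc_of_le (by linarith)]
          exact (intervalIntegrable_iff_integrableOn_Icc_of_le (by linarith)).1
            (hg (t + 1) (by linarith)))
    rw [uIcc_of_le (by linarith)] at h1
    exact h1.continuousAt (Icc_mem_nhds ht (by linarith))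
  have contF := cont_of _ intF
  have contA := cont_of _ intA
  have contB := cont_of _ intB
  have contG : ∀ t, 0 < t → ContinuousAt G t := fun t ht =>
    ((contA t ht).div (contB t ht) (posB t ht).ne').rpow_const
      (Or.inl (div_pos (posA t ht) (posB t ht)).ne')
  have contΦ : ∀ t, 0 < t → ContinuousAt Φ t := fun t ht =>
    continuousAt_const.mul ((contB t ht).mul ((contG t ht).rpow_const (Or.inl (posG t ht).ne')))
  have F_le : ∀ t, 0 ≤ t → F t ≤ ∫ s in Ioi (0 : ℝ), f s := fun t ht => by
    rw [hF]
    simp only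
    rw [intervalIntegral.integral_of_le ht]
    refine setIntegral_mono_set hint ?_ Ioc_subset_Ioi_self.eventuallyLE
    filter_upwards [ae_restrict_mem measurableSet_Ioi] with x hx using (hpos x hx).le
  have bound : ∀ a b, 0 < a → a ≤ b → ∫ t in a..b, G t ≤ C * ∫ s in Ioi (0 : ℝ), f s := by
    intro a b ha hab
    have h1 := integral_le_sub_of_mul_le_sub (Ψ := fun t => C * F t - Φ t) (G := G) hab
      (fun x hx => ((continuousAt_const.mul (contF x (ha.trans_le hx.1))).sub
        (contΦ x (ha.trans_le hx.1))).continuousWithinAt)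
      (fun x hx => (contG x (ha.trans_le hx)).continuousWithinAt)
      (fun s t hs hst => incr s t (ha.le.trans hs) hst)
    have h2 := incr 0 a le_rfl ha
    have h3 : Φ 0 = 0 := by simp [hΦ, B0]
    have h4 : F 0 = 0 := by simp [hF]
    have h5 : 0 ≤ Φ b := by
      have := nonnegB b (ha.le.trans hab)
      have := nonnegG b (ha.le.trans hab)
      simp only [hΦ]
      positivity
    have h6 : 0 < (a - 0) * G a := mul_pos (by linarith) (posG a ha)
    have h7 := mul_le_mul_of_nonneg_left (F_le b (ha.le.trans hab)) hC.le
    rw [h3, h4] at h2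
    linarith
  have hGeq : ∫ t in Ioi (0 : ℝ),
        ((∫ s in Ioo (0 : ℝ) t, f s ^ p) / (∫ s in Ioo (0 : ℝ) t, f s ^ q)) ^ (1 / (p - q))
      = ∫ t in Ioi (0 : ℝ), G t := by
    refine setIntegral_congr_fun measurableSet_Ioi fun t ht => ?_
    have ht' : (0 : ℝ) ≤ t := le_of_lt ht
    simp only [hG, hA, hB, intervalIntegral.integral_of_le ht', integral_Ioc_eq_integral_Ioo]
  rw [hGeq]
  by_cases hGint : IntegrableOn G (Ioi 0)
  · have hU : (⋃ n : ℕ, Ioc (1 / ((n : ℝ) + 1)) ((n : ℝ) + 1)) = Ioi 0 := by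
      ext x
      simp only [mem_iUnion, mem_Ioc, mem_Ioi]
      constructor
      · rintro ⟨n, hn, -⟩
        exact lt_trans (by positivity) hn
      · intro hx
        obtain ⟨n, hn⟩ := exists_nat_one_div_lt hx
        obtain ⟨m, hm⟩ := exists_nat_ge x
        refine ⟨max n m, lt_of_le_of_lt ?_ hn, ?_⟩
        · apply one_div_le_one_div_of_le (by positivity)
          gcongr
          exact le_max_left _ _
        · have : (m : ℝ) ≤ (max n m : ℕ) := by exact_mod_cast le_max_right _ _
          linarith
    have hlim := tendsto_setIntegral_of_monotone (μ := volume) (f := G)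
      (s := fun n : ℕ => Ioc (1 / ((n : ℝ) + 1)) ((n : ℝ) + 1)) (fun _ => measurableSet_Ioc)
      (fun m n hmn => Ioc_subset_Ioc (one_div_le_one_div_of_le (by positivity) (by gcongr))
        (by gcongr))
      (by rwa [hU])
    rw [hU] at hlim
    refine le_of_tendsto' hlim fun n => ?_
    have hn : 1 / ((n : ℝ) + 1) ≤ (n : ℝ) + 1 := by
      rw [div_le_iff₀ (by positivity)]
      nlinarith [Nat.cast_nonneg (α := ℝ) n]
    rw [← intervalIntegral.integral_of_le hn]
    exact bound _ _ (by positivity) hn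
  · rw [integral_undef hGint]
    exact mul_nonneg hC.le (setIntegral_nonneg measurableSet_Ioi fun x hx => (hpos x hx).le)

/-- Integral Hardy inequality for Gini means `G_{p,q}` with
`min(p,q) ≤ 0 ≤ max(p,q) < 1` and `p ≠ q`. -/
theorem integral_hardy_gini (p q : ℝ) (hpq : p ≠ q)
    (hmin : min p q ≤ 0) (hmax0 : 0 ≤ max p q) (hmax1 : max p q < 1)
    (f : ℝ → ℝ) (hmeas : Measurable f)
    (hint : IntegrableOn f (Set.Ioi 0))
    (hpos : ∀ t ∈ Set.Ioi (0:ℝ), 0 < f t)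
    (hp : ∀ t ∈ Set.Ioi (0:ℝ), IntegrableOn (fun s => f s ^ p) (Set.Ioo 0 t))
    (hq : ∀ t ∈ Set.Ioi (0:ℝ), IntegrableOn (fun s => f s ^ q) (Set.Ioo 0 t)) :
    ∫ t in Set.Ioi (0:ℝ),
        ((∫ s in Set.Ioo (0:ℝ) t, f s ^ p) / (∫ s in Set.Ioo (0:ℝ) t, f s ^ q)) ^ (1/(p-q))
      ≤ ((1 - q)/(1 - p)) ^ (1/(p-q)) * ∫ t in Set.Ioi (0:ℝ), f t := by
  rcases lt_or_gt_of_ne hpq with h | h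
  · rw [min_eq_left h.le] at hmin
    rw [max_eq_right h.le] at hmax0 hmax1
    have inv : ∀ a b : ℝ, 0 ≤ a → 0 ≤ b → (a / b) ^ (1 / (p - q)) = (b / a) ^ (1 / (q - p)) :=
      fun a b ha hb => by
        rw [← inv_div b a, Real.inv_rpow (div_nonneg hb ha), ← Real.rpow_neg (div_nonneg hb ha),
          ← neg_sub q p, one_div_neg_eq_neg_one_div, neg_neg]
    have nonneg : ∀ r t : ℝ, 0 ≤ ∫ s in Ioo (0 : ℝ) t, f s ^ r := fun r t =>
      setIntegral_nonneg measurableSet_Ioo fun x hx => (Real.rpow_pos_of_pos (hpos x hx.1) r).le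
    simp only [fun t => inv _ _ (nonneg p t) (nonneg q t)]
    rw [inv _ _ (by linarith) (by linarith)]
    exact integral_gini_le_of_lt h hmin hmax0 hmax1 hint hpos hq hp
  · rw [min_eq_right h.le] at hmin
    rw [max_eq_left h.le] at hmax0 hmax1
    exact integral_gini_le_of_lt h hmin hmax0 hmax1 hint hpos hp hq
end

section
/- Let r ≤ 0. Then for every Lebesgue measurable integrable function f : (0,∞) → (0,∞) such that for every t > 0 both s ↦ f(s)^r and s ↦ f(s)^r ln f(s) are integrable on (0,t), one has ∫₀^∞ exp( ∫₀^t f(s)^r ln f(s) ds / ∫₀^t f(s)^r ds ) dt ≤ e ∫₀^∞ f(t) dt. -/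
open MeasureTheory Set Real

/-- The primitive `t ↦ ∫₀ᵗ w`. -/
noncomputable def primitive (w : ℝ → ℝ) (t : ℝ) : ℝ := ∫ s in Ioo (0:ℝ) t, w s

section Primitive

variable {w : ℝ → ℝ} (hpos : ∀ t ∈ Ioi (0:ℝ), 0 < w t)
  (hint : ∀ t ∈ Ioi (0:ℝ), IntegrableOn w (Ioo 0 t))

lemma primitive_of_nonpos (w : ℝ → ℝ) {t : ℝ} (ht : t ≤ 0) : primitive w t = 0 := by
  simp [primitive, Ioo_eq_empty (not_lt.2 ht)]

lemma primitive_eq_intervalIntegral (w : ℝ → ℝ) {t : ℝ} (ht : 0 ≤ t) :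
    primitive w t = ∫ s in (0:ℝ)..t, w s := by
  rw [primitive, intervalIntegral.integral_of_le ht, integral_Ioc_eq_integral_Ioo]

include hint in
lemma intervalIntegrable_of_integrableOn_Ioo {a b : ℝ} (ha : 0 ≤ a) (hab : a ≤ b) :
    IntervalIntegrable w volume a b := by
  rw [intervalIntegrable_iff_integrableOn_Ioo_of_le hab]
  rcases hab.eq_or_lt with rfl | h
  · simp
  · exact (hint b (ha.trans_lt h)).mono_set (Ioo_subset_Ioo_left ha)

include hpos hint in
lemma primitive_strictMonoOn : StrictMonoOn (primitive w) (Ici 0) := by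
  intro a ha b hb hab
  have ha' : (0:ℝ) ≤ a := ha
  rw [primitive_eq_intervalIntegral w ha', primitive_eq_intervalIntegral w hb,
    ← intervalIntegral.integral_add_adjacent_intervals
      (intervalIntegrable_of_integrableOn_Ioo hint le_rfl ha')
      (intervalIntegrable_of_integrableOn_Ioo hint ha' hab.le)]
  have := intervalIntegral.intervalIntegral_pos_of_pos_on
    (intervalIntegrable_of_integrableOn_Ioo hint ha' hab.le)
    (fun x hx => hpos x (ha'.trans_lt hx.1)) hab
  linarith

include hpos hint in
lemma primitive_pos {t : ℝ} (ht : 0 < t) : 0 < primitive w t := by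
  have := primitive_strictMonoOn hpos hint (mem_Ici.2 le_rfl) (mem_Ici.2 ht.le) ht
  rwa [primitive_of_nonpos w le_rfl] at this

include hpos hint in
lemma primitive_monotone : Monotone (primitive w) := by
  intro a b hab
  rcases le_or_gt a 0 with ha | ha
  · rw [primitive_of_nonpos w ha]
    rcases le_or_gt b 0 with hb | hb
    · rw [primitive_of_nonpos w hb]
    · exact (primitive_pos hpos hint hb).le
  · exact (primitive_strictMonoOn hpos hint).monotoneOn ha.le (ha.le.trans hab) hab

include hint in
lemma primitive_continuousOn {t : ℝ} (ht : 0 < t) :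
    ContinuousOn (primitive w) (Icc 0 t) := by
  have h : IntegrableOn w (Icc 0 t) := by
    rw [integrableOn_Icc_iff_integrableOn_Ioo]; exact hint t ht
  refine (intervalIntegral.continuousOn_primitive h).congr fun x _ => ?_
  exact integral_Ioc_eq_integral_Ioo.symm

include hpos hint in
lemma setLIntegral_Ioc_eq_primitive {t : ℝ} (ht : 0 ≤ t) :
    ∫⁻ s in Ioc 0 t, ENNReal.ofReal (w s) = ENNReal.ofReal (primitive w t) := by
  rw [primitive, ← integral_Ioc_eq_integral_Ioo, ofReal_integral_eq_lintegral_ofReal]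
  · exact (intervalIntegrable_iff_integrableOn_Ioc_of_le ht).1
      (intervalIntegrable_of_integrableOn_Ioo hint le_rfl ht)
  · exact (ae_restrict_iff' measurableSet_Ioc).2 (.of_forall fun x hx => (hpos x hx.1).le)

include hpos hint in
/-- The primitive of `w` pushes the measure `w(s) ds` forward to Lebesgue measure. -/
lemma map_primitive_withDensity {t : ℝ} (ht : 0 < t) :
    Measure.map (primitive w)
      ((volume.restrict (Ioc 0 t)).withDensity fun s => ENNReal.ofReal (w s)) =
      volume.restrict (Ioc 0 (primitive w t)) := by
  set ν := (volume.restrict (Ioc 0 t)).withDensity fun s => ENNReal.ofReal (w s) with hν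
  have hm : Measurable (primitive w) := (primitive_monotone hpos hint).measurable
  have hsub : ∀ A : Set ℝ, MeasurableSet A →
      ν A = ∫⁻ s in A ∩ Ioc 0 t, ENNReal.ofReal (w s) := by
    intro A hA
    rw [hν, withDensity_apply _ hA, Measure.restrict_restrict hA]
  symm
  refine Measure.ext_of_Iic _ _ fun a => ?_
  rw [Measure.map_apply hm measurableSet_Iic, hsub _ (hm measurableSet_Iic),
    Measure.restrict_apply measurableSet_Iic]
  rcases lt_or_ge a 0 with ha | ha
  · have h1 : primitive w ⁻¹' Iic a ∩ Ioc 0 t = ∅ := by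
      ext x
      simp only [mem_inter_iff, mem_preimage, mem_Iic, mem_Ioc, mem_empty_iff_false, iff_false]
      rintro ⟨h, h0, -⟩
      linarith [primitive_pos hpos hint h0]
    have h2 : Iic a ∩ Ioc 0 (primitive w t) = ∅ := by
      ext x
      simp only [mem_inter_iff, mem_Iic, mem_Ioc, mem_empty_iff_false, iff_false]
      rintro ⟨h, h0, -⟩
      linarith
    simp [h1, h2]
  · obtain ⟨u, hu, hua⟩ : ∃ u ∈ Icc 0 t, primitive w u = min a (primitive w t) := by
      have := intermediate_value_Icc ht.le (primitive_continuousOn hint ht)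
      rw [primitive_of_nonpos w le_rfl] at this
      exact this ⟨le_min ha (primitive_pos hpos hint ht).le, min_le_right _ _⟩
    have h1 : primitive w ⁻¹' Iic a ∩ Ioc 0 t = Ioc 0 u := by
      ext x
      simp only [mem_inter_iff, mem_preimage, mem_Iic, mem_Ioc]
      constructor
      · rintro ⟨h, h0, hxt⟩
        refine ⟨h0, ?_⟩
        rw [← (primitive_strictMonoOn hpos hint).le_iff_le h0.le hu.1, hua]
        exact le_min h (primitive_monotone hpos hint hxt)
      · rintro ⟨h0, hxu⟩
        exact ⟨((primitive_monotone hpos hint hxu).trans hua.le).trans (min_le_left _ _),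
          h0, hxu.trans hu.2⟩
    have h2 : Iic a ∩ Ioc 0 (primitive w t) = Ioc 0 (min a (primitive w t)) := by
      ext x
      simp only [mem_inter_iff, mem_Iic, mem_Ioc, le_min_iff]
      tauto
    rw [h1, h2, setLIntegral_Ioc_eq_primitive hpos hint hu.1, hua, Real.volume_Ioc, sub_zero]

include hpos hint in
lemma integrableOn_mul_log_primitive (hw : Measurable w) {t : ℝ} (ht : 0 < t) :
    IntegrableOn (fun s => w s * log (primitive w s)) (Ioc 0 t) ∧
      ∫ s in Ioc 0 t, w s * log (primitive w s) =
        primitive w t * log (primitive w t) - primitive w t := by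
  have hm : Measurable (primitive w) := (primitive_monotone hpos hint).measurable
  have hW := primitive_pos hpos hint ht
  have hmap := map_primitive_withDensity hpos hint ht
  have hlog : IntegrableOn log (Ioc 0 (primitive w t)) :=
    (intervalIntegrable_iff_integrableOn_Ioc_of_le hW.le).1 intervalIntegral.intervalIntegrable_log'
  have hlt : ∀ᵐ x ∂volume.restrict (Ioc 0 t), ENNReal.ofReal (w x) < ⊤ :=
    .of_forall fun _ => ENNReal.ofReal_lt_top
  have heq : EqOn (fun s => (ENNReal.ofReal (w s)).toReal • log (primitive w s))
      (fun s => w s * log (primitive w s)) (Ioc 0 t) := fun s hs => by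
    simp [ENNReal.toReal_ofReal (hpos s hs.1).le]
  constructor
  · rw [IntegrableOn, ← hmap, integrable_map_measure measurable_log.aestronglyMeasurable
      hm.aemeasurable, integrable_withDensity_iff_integrable_smul' hw.ennreal_ofReal hlt] at hlog
    exact IntegrableOn.congr_fun hlog heq measurableSet_Ioc
  · rw [← setIntegral_congr_fun measurableSet_Ioc heq,
      ← integral_withDensity_eq_integral_toReal_smul hw.ennreal_ofReal hlt,
      ← integral_map hm.aemeasurable measurable_log.aestronglyMeasurable, hmap,
      ← intervalIntegral.integral_of_le hW.le, integral_log]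
    simp

include hpos hint in
lemma setLIntegral_Ioi_div_primitive_sq_le (hw : Measurable w) {s : ℝ} (hs : 0 < s) :
    ∫⁻ t in Ioi s, ENNReal.ofReal (w t) * ENNReal.ofReal (primitive w t ^ (-2:ℝ)) ≤
      ENNReal.ofReal ((primitive w s)⁻¹) := by
  have hm : Measurable (primitive w) := (primitive_monotone hpos hint).measurable
  have hU : Ioi s = ⋃ n : ℕ, Ioc s n := by
    ext x
    simp only [mem_Ioi, mem_iUnion, mem_Ioc]
    exact ⟨fun h => (exists_nat_ge x).imp fun n hn => ⟨h, hn⟩, fun ⟨_, h, _⟩ => h⟩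
  rw [hU, setLIntegral_iUnion_of_directed]
  swap
  · exact (show Monotone fun n : ℕ => Ioc s (n:ℝ) from
      fun m n h => Ioc_subset_Ioc_right (by exact_mod_cast h)).directed_le
  refine iSup_le fun n => ?_
  rcases le_or_gt (n:ℝ) s with hn | hn
  · simp [Ioc_eq_empty (not_lt.2 hn)]
  have hn0 := hs.trans hn
  have hWs := primitive_pos hpos hint hs
  set φ : ℝ → ENNReal :=
    (Ioi (primitive w s)).indicator fun x => ENNReal.ofReal (x ^ (-2:ℝ)) with hφ
  have hφm : Measurable φ := by
    refine Measurable.indicator ?_ measurableSet_Ioi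
    fun_prop
  calc ∫⁻ t in Ioc s n, ENNReal.ofReal (w t) * ENNReal.ofReal (primitive w t ^ (-2:ℝ))
      = ∫⁻ t in Ioc s n, ENNReal.ofReal (w t) * φ (primitive w t) := by
        refine setLIntegral_congr_fun measurableSet_Ioc fun t ht => ?_
        have : primitive w t ∈ Ioi (primitive w s) :=
          primitive_strictMonoOn hpos hint hs.le (hs.trans ht.1).le ht.1
        simp only [hφ, indicator_of_mem this]
    _ ≤ ∫⁻ t in Ioc 0 (n:ℝ), ENNReal.ofReal (w t) * φ (primitive w t) :=
        lintegral_mono_set (Ioc_subset_Ioc_left hs.le)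
    _ = ∫⁻ x in Ioc 0 (primitive w n), φ x := by
        rw [← map_primitive_withDensity hpos hint hn0, lintegral_map hφm hm,
          lintegral_withDensity_eq_lintegral_mul _ hw.ennreal_ofReal
            (g := fun t => φ (primitive w t)) (hφm.comp hm)]
        rfl
    _ ≤ ∫⁻ x, φ x := setLIntegral_le_lintegral _ _
    _ = ENNReal.ofReal ((primitive w s)⁻¹) := by
        rw [hφ, lintegral_indicator measurableSet_Ioi, ← ofReal_integral_eq_lintegral_ofReal
          (integrableOn_Ioi_rpow_of_lt (by norm_num) hWs)
          ((ae_restrict_iff' measurableSet_Ioi).2 (.of_forall fun x hx =>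
            rpow_nonneg (hWs.trans hx).le _)), integral_Ioi_rpow_of_lt (by norm_num) hWs]
        norm_num [rpow_neg_one]

end Primitive

section Gini

variable {f : ℝ → ℝ} {r : ℝ} (hpos : ∀ t ∈ Ioi (0:ℝ), 0 < f t)
  (hr1 : ∀ t ∈ Ioi (0:ℝ), IntegrableOn (fun s => f s ^ r) (Ioo 0 t))

include hpos hr1 in
lemma integrableOn_mul_primitive (hmeas : Measurable f) {t : ℝ} (hf : IntegrableOn f (Ioc 0 t)) :
    IntegrableOn (fun s => f s * primitive (fun s => f s ^ r) s) (Ioc 0 t) := by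
  have hwpos : ∀ s ∈ Ioi (0:ℝ), 0 < f s ^ r := fun s hs => rpow_pos_of_pos (hpos s hs) r
  have hmono := primitive_monotone hwpos hr1
  refine Integrable.mono' (hf.mul_const (primitive (fun s => f s ^ r) t))
    (hmeas.mul hmono.measurable).aestronglyMeasurable ?_
  refine (ae_restrict_iff' measurableSet_Ioc).2 (.of_forall fun s hs => ?_)
  rw [norm_of_nonneg (mul_pos (hpos s hs.1) (primitive_pos hwpos hr1 hs.1)).le]
  exact mul_le_mul_of_nonneg_left (hmono hs.2) (hpos s hs.1).le

include hpos hr1 in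
/-- Jensen's inequality for the exponential with respect to the weight `f ^ r`. -/
lemma exp_gini_rpow_mul_sq_le (hmeas : Measurable f) {t : ℝ} (ht : 0 < t)
    (hf : IntegrableOn f (Ioc 0 t))
    (hr2 : IntegrableOn (fun s => f s ^ r * log (f s)) (Ioc 0 t)) :
    exp ((∫ s in Ioc 0 t, f s ^ r * log (f s)) / primitive (fun s => f s ^ r) t) ^ (1 - r) *
        primitive (fun s => f s ^ r) t ^ 2 ≤
      exp 1 * ∫ s in Ioc 0 t, f s * primitive (fun s => f s ^ r) s := by
  have hwpos : ∀ s ∈ Ioi (0:ℝ), 0 < f s ^ r := fun s hs => rpow_pos_of_pos (hpos s hs) r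
  have hwm : Measurable fun s => f s ^ r := hmeas.pow_const r
  set W := primitive fun s => f s ^ r with hWdef
  have hmono : Monotone W := primitive_monotone hwpos hr1
  have hW : ∀ s, 0 < s → 0 < W s := fun s hs => primitive_pos hwpos hr1 hs
  obtain ⟨hlogi, hlog⟩ := integrableOn_mul_log_primitive hwpos hr1 hwm ht
  rw [← hWdef] at hlogi hlog
  have hwi : IntegrableOn (fun s => f s ^ r) (Ioc 0 t) :=
    (intervalIntegrable_iff_integrableOn_Ioc_of_le ht.le).1
      (intervalIntegrable_of_integrableOn_Ioo hr1 le_rfl ht.le)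
  have hwW : ∫ s in Ioc 0 t, f s ^ r = W t := integral_Ioc_eq_integral_Ioo
  have hfW : IntegrableOn (fun s => f s * W s) (Ioc 0 t) :=
    integrableOn_mul_primitive hpos hr1 hmeas hf
  set A := ∫ s in Ioc 0 t, f s ^ r * log (f s)
  set c := (1 - r) * (A / W t) + log (W t) - 1 with hc
  have hWt := hW t ht
  have hpt : ∀ s ∈ Ioc 0 t, exp c * ((1 - c) * f s ^ r + (1 - r) * (f s ^ r * log (f s)) +
      f s ^ r * log (W s)) ≤ f s * W s := by
    intro s hs
    have hfs := hpos s hs.1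
    have hWs := hW s hs.1
    have key : f s * W s = f s ^ r * (exp c * exp ((1 - r) * log (f s) + log (W s) - c)) := by
      rw [← exp_add, add_sub_cancel, exp_add, exp_log hWs, mul_comm (1 - r), ← rpow_def_of_pos hfs,
        ← mul_assoc, ← rpow_add hfs, add_sub_cancel, rpow_one]
    have h1 := add_one_le_exp ((1 - r) * log (f s) + log (W s) - c)
    have h2 := mul_le_mul_of_nonneg_left h1 (mul_pos (hwpos s hs.1) (exp_pos c)).le
    rw [key]
    linarith
  have hi1 : IntegrableOn (fun s => (1 - c) * f s ^ r + (1 - r) * (f s ^ r * log (f s)))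
      (Ioc 0 t) := (hwi.const_mul _).add (hr2.const_mul _)
  have hmain := setIntegral_mono_on ((hi1.add hlogi).const_mul (exp c)) hfW measurableSet_Ioc hpt
  simp only [Pi.add_apply] at hmain
  rw [integral_const_mul, integral_add hi1 hlogi,
    integral_add (hwi.const_mul _) (hr2.const_mul _), integral_const_mul, integral_const_mul,
    hwW, hlog] at hmain
  have hval : (1 - c) * W t + (1 - r) * A + (W t * log (W t) - W t) = W t := by
    rw [hc]; field_simp; ring
  rw [hval] at hmain
  have hexp : exp (A / W t) ^ (1 - r) * W t ^ 2 = exp 1 * (exp c * W t) := by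
    rw [← exp_mul, ← mul_assoc, ← exp_add, hc, add_sub_cancel, exp_add, exp_log hWt]
    ring_nf
  rw [hexp]
  exact mul_le_mul_of_nonneg_left hmain (exp_pos 1).le

/-- Weighted AM-GM, in the form used to compare `x` with `x ^ (1 - r) * y ^ r` and `y`. -/
lemma le_rpow_mul_rpow_add (hr : r ≤ 0) {x y : ℝ} (hx : 0 < x) (hy : 0 < y) :
    x ≤ (1 - r)⁻¹ * (x ^ (1 - r) * y ^ r) + (1 - (1 - r)⁻¹) * y := by
  have h0 : 0 < 1 - r := by linarith
  have h1 : (1 - r)⁻¹ ≤ 1 := inv_le_one_of_one_le₀ (by linarith)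
  have h := geom_mean_le_arith_mean2_weighted (p₁ := x ^ (1 - r) * y ^ r) (p₂ := y)
    (inv_pos.2 h0).le (sub_nonneg.2 h1) (by positivity) hy.le (add_sub_cancel _ _)
  refine le_of_eq_of_le ?_ h
  rw [mul_rpow (by positivity) (by positivity), ← rpow_mul hx.le, ← rpow_mul hy.le,
    mul_inv_cancel₀ h0.ne', rpow_one, mul_assoc, ← rpow_add hy]
  have : r * (1 - r)⁻¹ + (1 - (1 - r)⁻¹) = 0 := by field_simp; ring
  rw [this, rpow_zero, mul_one]

include hpos hr1 in
/-- Weighted Carleman–Knopp inequality with the weight `f ^ r`. -/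
lemma lintegral_exp_gini_rpow_mul_le (hmeas : Measurable f) (hf : IntegrableOn f (Ioi 0))
    (hr2 : ∀ t ∈ Ioi (0:ℝ), IntegrableOn (fun s => f s ^ r * log (f s)) (Ioc 0 t)) :
    ∫⁻ t in Ioi 0, ENNReal.ofReal (exp ((∫ s in Ioc 0 t, f s ^ r * log (f s)) /
        primitive (fun s => f s ^ r) t) ^ (1 - r) * f t ^ r) ≤
      ENNReal.ofReal (exp 1) * ∫⁻ t in Ioi 0, ENNReal.ofReal (f t) := by
  have hwpos : ∀ s ∈ Ioi (0:ℝ), 0 < f s ^ r := fun s hs => rpow_pos_of_pos (hpos s hs) r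
  have hwm : Measurable fun s => f s ^ r := hmeas.pow_const r
  set W := primitive fun s => f s ^ r with hWdef
  have hmono : Monotone W := primitive_monotone hwpos hr1
  have hW : ∀ s, 0 < s → 0 < W s := fun s hs => primitive_pos hwpos hr1 hs
  have hWm : Measurable W := hmono.measurable
  set k : ℝ → ENNReal := fun t => ENNReal.ofReal (f t ^ r) * ENNReal.ofReal (W t ^ (-2:ℝ)) with hk
  set g : ℝ → ENNReal := fun s => ENNReal.ofReal (f s) * ENNReal.ofReal (W s) with hg
  have hkm : Measurable k := by fun_prop
  have hgm : Measurable g := by fun_prop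
  have hpt : ∀ t ∈ Ioi (0:ℝ), ENNReal.ofReal (exp ((∫ s in Ioc 0 t, f s ^ r * log (f s)) /
      W t) ^ (1 - r) * f t ^ r) ≤
      ENNReal.ofReal (exp 1) * ∫⁻ s in Ioi 0, (Ici s).indicator k t * g s := by
    intro t ht
    have ht0 : (0:ℝ) < t := ht
    have hft : IntegrableOn f (Ioc 0 t) := hf.mono_set fun x hx => hx.1
    have hJ := exp_gini_rpow_mul_sq_le hpos hr1 hmeas ht0 hft (hr2 t ht)
    rw [← hWdef] at hJ
    have hWt := hW t ht
    have hreal : exp ((∫ s in Ioc 0 t, f s ^ r * log (f s)) / W t) ^ (1 - r) * f t ^ r ≤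
        exp 1 * ((f t ^ r * W t ^ (-2:ℝ)) * ∫ s in Ioc 0 t, f s * W s) := by
      have h := mul_le_mul_of_nonneg_right hJ
        (mul_pos (hwpos t ht) (rpow_pos_of_pos hWt (-2))).le
      have h2 : W t ^ 2 * W t ^ (-2:ℝ) = 1 := by
        rw [← rpow_natCast, ← rpow_add hWt]; norm_num
      refine le_of_eq_of_le ?_ (h.trans_eq (by ring))
      linear_combination (-(exp ((∫ s in Ioc 0 t, f s ^ r * log (f s)) / W t) ^ (1 - r) *
        f t ^ r)) * h2
    refine (ENNReal.ofReal_le_ofReal hreal).trans ?_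
    rw [ENNReal.ofReal_mul (exp_pos 1).le,
      ENNReal.ofReal_mul (mul_pos (hwpos t ht) (rpow_pos_of_pos hWt (-2))).le,
      ENNReal.ofReal_mul (hwpos t ht).le, ofReal_integral_eq_lintegral_ofReal
        (integrableOn_mul_primitive hpos hr1 hmeas hft)
        ((ae_restrict_iff' measurableSet_Ioc).2 (.of_forall fun s hs =>
          (mul_pos (hpos s hs.1) (hW s hs.1)).le))]
    refine mul_le_mul_right ?_ _
    rw [← lintegral_const_mul' _ _
      (ENNReal.mul_ne_top ENNReal.ofReal_ne_top ENNReal.ofReal_ne_top)]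
    refine le_trans (le_of_eq ?_) (lintegral_mono_set (Ioc_subset_Ioi_self (a := t) (b := 0)))
    refine setLIntegral_congr_fun measurableSet_Ioc fun s hs => ?_
    simp only [indicator_of_mem (mem_Ici.2 hs.2), hk, hg, hWdef,
      ENNReal.ofReal_mul (hpos s hs.1).le]
  refine (setLIntegral_mono' measurableSet_Ioi hpt).trans ?_
  rw [lintegral_const_mul' _ _ ENNReal.ofReal_ne_top]
  refine mul_le_mul_right ?_ _
  rw [lintegral_lintegral_swap]
  swap
  · have : (Function.uncurry fun t s => (Ici s).indicator k t * g s) =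
        {p : ℝ × ℝ | p.2 ≤ p.1}.indicator fun p => k p.1 * g p.2 := by
      ext ⟨t, s⟩
      by_cases h : s ≤ t <;> simp [h]
    rw [this]
    exact (Measurable.indicator (by fun_prop)
      (measurableSet_le measurable_snd measurable_fst)).aemeasurable
  refine setLIntegral_mono' measurableSet_Ioi fun s hs => ?_
  have hfin : g s ≠ ⊤ := ENNReal.mul_ne_top ENNReal.ofReal_ne_top ENNReal.ofReal_ne_top
  have hWs := hW s hs
  rw [lintegral_mul_const' _ _ hfin]
  calc (∫⁻ t in Ioi 0, (Ici s).indicator k t) * g s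
      ≤ (∫⁻ t in Ioi s, k t) * g s := by
        refine mul_le_mul_left ?_ _
        refine (setLIntegral_le_lintegral _ _).trans_eq ?_
        rw [lintegral_indicator measurableSet_Ici, setLIntegral_congr Ioi_ae_eq_Ici]
    _ ≤ ENNReal.ofReal (W s)⁻¹ * g s :=
        mul_le_mul_left (setLIntegral_Ioi_div_primitive_sq_le hwpos hr1 hwm hs) _
    _ = ENNReal.ofReal (f s) := by
        simp only [hg]
        rw [← ENNReal.ofReal_mul (hpos s hs).le, ← ENNReal.ofReal_mul (inv_pos.2 hWs).le]
        congr 1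
        field_simp

end Gini


/-- Integral Hardy inequality with constant `e` for the diagonal Gini means
`G_{r,r}` with `r ≤ 0`. -/
theorem integral_hardy_gini_diag (r : ℝ) (hr : r ≤ 0)
    (f : ℝ → ℝ) (hmeas : Measurable f)
    (hint : IntegrableOn f (Set.Ioi 0))
    (hpos : ∀ t ∈ Set.Ioi (0:ℝ), 0 < f t)
    (hr1 : ∀ t ∈ Set.Ioi (0:ℝ), IntegrableOn (fun s => f s ^ r) (Set.Ioo 0 t))
    (hr2 : ∀ t ∈ Set.Ioi (0:ℝ),
      IntegrableOn (fun s => f s ^ r * Real.log (f s)) (Set.Ioo 0 t)) :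
    ∫ t in Set.Ioi (0:ℝ),
        Real.exp ((∫ s in Set.Ioo (0:ℝ) t, f s ^ r * Real.log (f s)) /
          (∫ s in Set.Ioo (0:ℝ) t, f s ^ r))
      ≤ Real.exp 1 * ∫ t in Set.Ioi (0:ℝ), f t := by
  have hnn : ∀ᵐ t ∂volume.restrict (Ioi (0:ℝ)), 0 ≤ f t :=
    (ae_restrict_iff' measurableSet_Ioi).2 (.of_forall fun t ht => (hpos t ht).le)
  set H : ℝ → ℝ := fun t => exp ((∫ s in Ioo (0:ℝ) t, f s ^ r * log (f s)) /
    (∫ s in Ioo (0:ℝ) t, f s ^ r)) with hH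
  have hRHS : 0 ≤ exp 1 * ∫ t in Ioi (0:ℝ), f t :=
    mul_nonneg (exp_pos 1).le (integral_nonneg_of_ae hnn)
  by_cases hHi : IntegrableOn H (Ioi 0)
  swap
  · rwa [integral_undef hHi]
  rw [← ENNReal.ofReal_le_ofReal_iff hRHS, ENNReal.ofReal_mul (exp_pos 1).le,
    ofReal_integral_eq_lintegral_ofReal hHi (.of_forall fun _ => (exp_pos _).le),
    ofReal_integral_eq_lintegral_ofReal hint hnn]
  have hr2' : ∀ t ∈ Ioi (0:ℝ), IntegrableOn (fun s => f s ^ r * log (f s)) (Ioc 0 t) :=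
    fun t ht => (intervalIntegrable_iff_integrableOn_Ioc_of_le (le_of_lt ht)).1
      (intervalIntegrable_of_integrableOn_Ioo hr2 le_rfl (le_of_lt ht))
  have hK := lintegral_exp_gini_rpow_mul_le hpos hr1 hmeas hint hr2'
  simp only [integral_Ioc_eq_integral_Ioo, primitive] at hK
  set I := ∫⁻ t in Ioi (0:ℝ), ENNReal.ofReal (f t)
  have h0 : 0 < (1 - r)⁻¹ := inv_pos.2 (by linarith)
  have h1 : 0 ≤ 1 - (1 - r)⁻¹ := sub_nonneg.2 (inv_le_one_of_one_le₀ (by linarith))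
  calc ∫⁻ t in Ioi 0, ENNReal.ofReal (H t)
      ≤ ∫⁻ t in Ioi 0, (ENNReal.ofReal (1 - r)⁻¹ * ENNReal.ofReal (H t ^ (1 - r) * f t ^ r) +
          ENNReal.ofReal (1 - (1 - r)⁻¹) * ENNReal.ofReal (f t)) := by
        refine setLIntegral_mono' measurableSet_Ioi fun t ht => ?_
        rw [← ENNReal.ofReal_mul h0.le, ← ENNReal.ofReal_mul h1]
        exact (ENNReal.ofReal_le_ofReal (le_rpow_mul_rpow_add hr (exp_pos _) (hpos t ht))).trans
          ENNReal.ofReal_add_le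
    _ = ENNReal.ofReal (1 - r)⁻¹ * (∫⁻ t in Ioi 0, ENNReal.ofReal (H t ^ (1 - r) * f t ^ r)) +
          ENNReal.ofReal (1 - (1 - r)⁻¹) * I := by
        rw [lintegral_add_right _ (by fun_prop), lintegral_const_mul' _ _ ENNReal.ofReal_ne_top,
          lintegral_const_mul' _ _ ENNReal.ofReal_ne_top]
    _ ≤ ENNReal.ofReal (1 - r)⁻¹ * (ENNReal.ofReal (exp 1) * I) +
          ENNReal.ofReal (1 - (1 - r)⁻¹) * (ENNReal.ofReal (exp 1) * I) := by
        gcongr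
        refine le_mul_of_one_le_left' ?_
        rw [ENNReal.one_le_ofReal]
        exact one_le_exp zero_le_one
    _ = ENNReal.ofReal (exp 1) * I := by
        rw [← add_mul, ← ENNReal.ofReal_add h0.le h1, add_sub_cancel, ENNReal.ofReal_one, one_mul]
end

section
/- Let I ⊆ ℝ be a nonempty interval and let E : I × I → ℝ be continuous with E(x,x) = 0 for all x ∈ I and with y ↦ E(x,y) strictly decreasing on I for every x ∈ I. Let [a,b] ⊆ I be a compact subinterval and let f : [0,1] → [a,b] be Lebesgue measurable. Then there exists a unique y ∈ I such that ∫₀¹ E(f(t), y) dt = 0, and this y satisfies inf_{t∈[0,1]} f(t) ≤ y ≤ sup_{t∈[0,1]} f(t). -/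
open MeasureTheory Set Real

theorem integral_pos_of_forall_ae_pos {Ω : Type*} [MeasurableSpace Ω] {μ : Measure Ω}
    [NeZero μ] {g : Ω → ℝ} (hg : Integrable g μ) (hpos : ∀ᵐ t ∂μ, 0 < g t) :
    0 < ∫ t, g t ∂μ := by
  have h0 : 0 ≤ᵐ[μ] g := hpos.mono fun _ h => h.le
  refine (integral_nonneg_of_ae h0).lt_of_ne fun h => ?_
  have hz := (integral_eq_zero_iff_of_nonneg_ae h0 hg).1 h.symm
  obtain ⟨t, ht, ht'⟩ := (hpos.and hz).exists
  exact ht.ne' ht'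

/-- A function continuous on a compact interval is integrable when composed with a measurable
function taking values in that interval. -/
theorem ContinuousOn.integrable_comp_of_ae_mem_Icc {Ω : Type*} [MeasurableSpace Ω]
    {μ : Measure Ω} [IsFiniteMeasure μ] {f : Ω → ℝ} {a b : ℝ} (hab : a ≤ b)
    (hf : AEMeasurable f μ) (hfab : ∀ᵐ t ∂μ, f t ∈ Icc a b) {g : ℝ → ℝ}
    (hg : ContinuousOn g (Icc a b)) : Integrable (fun t => g (f t)) μ := by
  obtain ⟨C, hC⟩ := isCompact_Icc.exists_bound_of_continuousOn hg
  have hext : Continuous (IccExtend hab ((Icc a b).domRestrict g)) :=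
    (continuousOn_iff_continuous_domRestrict.1 hg).Icc_extend'
  have hmeas : AEStronglyMeasurable (fun t => g (f t)) μ := by
    refine (hext.measurable.comp_aemeasurable hf).aestronglyMeasurable.congr ?_
    filter_upwards [hfab] with t ht
    simp [IccExtend_of_mem hab _ ht]
  exact Integrable.of_bound hmeas C (hfab.mono fun t ht => hC _ ht)

/-- Existence and uniqueness of the integral deviation mean of a measurable
function `f : [0,1] → [a,b]` for a continuous deviation `E` on an interval `I`. -/
theorem integral_deviation_mean_exists_unique
    (I : Set ℝ) (hIne : I.Nonempty) (hIconn : I.OrdConnected)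
    (E : ℝ → ℝ → ℝ)
    (hEcont : ContinuousOn (fun z : ℝ × ℝ => E z.1 z.2) (I ×ˢ I))
    (hEdiag : ∀ x ∈ I, E x x = 0)
    (hEanti : ∀ x ∈ I, StrictAntiOn (fun y => E x y) I)
    (a b : ℝ) (hab : a ≤ b) (habI : Set.Icc a b ⊆ I)
    (f : ℝ → ℝ)
    (hfmeas : AEMeasurable f (volume.restrict (Set.Icc (0:ℝ) 1)))
    (hfab : ∀ t ∈ Set.Icc (0:ℝ) 1, f t ∈ Set.Icc a b) :
    (∃! y : ℝ, y ∈ I ∧ ∫ t in Set.Icc (0:ℝ) 1, E (f t) y = 0) ∧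
    (∀ y : ℝ, y ∈ I → (∫ t in Set.Icc (0:ℝ) 1, E (f t) y) = 0 →
      sInf (f '' Set.Icc (0:ℝ) 1) ≤ y ∧ y ≤ sSup (f '' Set.Icc (0:ℝ) 1)) := by
  set μ : Measure ℝ := volume.restrict (Icc (0:ℝ) 1) with hμ
  have : NeZero μ := ⟨by simp [hμ, Measure.restrict_eq_zero]⟩
  have hmem : ∀ᵐ t ∂μ, t ∈ Icc (0:ℝ) 1 := ae_restrict_mem measurableSet_Icc
  have hfae : ∀ᵐ t ∂μ, f t ∈ Icc a b := hmem.mono hfab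
  have hint : ∀ y ∈ I, Integrable (fun t => E (f t) y) μ := fun y hy =>
    ContinuousOn.integrable_comp_of_ae_mem_Icc (g := fun x => E x y) hab hfmeas hfae
      (hEcont.comp (f := fun x : ℝ => (x, y)) (by fun_prop) fun x hx => ⟨habI hx, hy⟩)
  have hanti : StrictAntiOn (fun y => ∫ t, E (f t) y ∂μ) I := by
    intro y hy z hz hyz
    have h := integral_pos_of_forall_ae_pos ((hint y hy).sub (hint z hz)) <| by
      filter_upwards [hfae] with t ht
      exact sub_pos.2 (hEanti _ (habI ht) hy hz hyz)
    simp only [Pi.sub_apply] at h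
    rw [integral_sub (hint y hy) (hint z hz)] at h
    exact sub_pos.1 h
  have hcont : ContinuousOn (fun y => ∫ t, E (f t) y ∂μ) (Icc a b) := by
    obtain ⟨C, hC⟩ := (isCompact_Icc.prod isCompact_Icc).exists_bound_of_continuousOn
      (hEcont.mono (prod_mono habI habI))
    refine continuousOn_of_dominated (bound := fun _ => C)
      (fun y hy => (hint y (habI hy)).aestronglyMeasurable) (fun y hy => ?_)
      (integrable_const C) ?_
    · filter_upwards [hfae] with t ht
      exact hC (f t, y) ⟨ht, hy⟩
    · filter_upwards [hfae] with t ht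
      exact hEcont.comp (f := fun y : ℝ => (f t, y)) (by fun_prop)
        fun y hy => ⟨habI ht, habI hy⟩
  have haI : a ∈ I := habI ⟨le_rfl, hab⟩
  have hbI : b ∈ I := habI ⟨hab, le_rfl⟩
  have h0a : 0 ≤ ∫ t, E (f t) a ∂μ := by
    refine integral_nonneg_of_ae ?_
    filter_upwards [hfae] with t ht
    exact (hEdiag _ (habI ht)).ge.trans ((hEanti _ (habI ht)).antitoneOn haI (habI ht) ht.1)
  have h0b : ∫ t, E (f t) b ∂μ ≤ 0 := by
    refine integral_nonpos_of_ae ?_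
    filter_upwards [hfae] with t ht
    exact ((hEanti _ (habI ht)).antitoneOn (habI ht) hbI ht.2).trans (hEdiag _ (habI ht)).le
  obtain ⟨y, hy, hy0⟩ := intermediate_value_Icc' hab hcont ⟨h0b, h0a⟩
  refine ⟨⟨y, ⟨habI hy, hy0⟩, fun z hz => hanti.injOn hz.1 (habI hy) (hz.2.trans hy0.symm)⟩,
    fun z hz hz0 => ⟨?_, ?_⟩⟩
  · by_contra! hlt
    refine (integral_pos_of_forall_ae_pos (hint z hz) ?_).ne' hz0
    filter_upwards [hmem] with t ht
    have hle : sInf (f '' Icc (0:ℝ) 1) ≤ f t :=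
      csInf_le ⟨a, forall_mem_image.2 fun s hs => (hfab s hs).1⟩ (mem_image_of_mem f ht)
    have hI := habI (hfab t ht)
    exact (hEdiag _ hI).ge.trans_lt (hEanti _ hI hz hI (hlt.trans_le hle))
  · by_contra! hlt
    refine (integral_pos_of_forall_ae_pos (hint z hz).neg ?_).ne' ?_
    · filter_upwards [hmem] with t ht
      have hle : f t ≤ sSup (f '' Icc (0:ℝ) 1) :=
        le_csSup ⟨b, forall_mem_image.2 fun s hs => (hfab s hs).2⟩ (mem_image_of_mem f ht)
      have hI := habI (hfab t ht)
      exact neg_pos.2 ((hEanti _ hI hI hz (hle.trans_lt hlt)).trans_le (hEdiag _ hI).le)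
    · simp only [Pi.neg_apply]
      rw [integral_neg, hz0, neg_zero]
end

section
/- Let h : (0,∞) → ℝ be strictly increasing and concave with h(1) = 0 and ∫₀¹ h(1/t) dt < +∞, and let c ∈ (0,∞) be the unique number with ∫₀^c h(1/t) dt = 0. Let g : (0,∞) → (0,∞) be Lebesgue integrable and suppose that for every t > 0 there exists y_t ∈ (0,∞) such that s ↦ h(g(s)/y_t) is integrable on (0,t) with ∫₀^t h(g(s)/y_t) ds = 0, and that the map t ↦ y_t is Lebesgue measurable. Then ∫₀^∞ y_t dt ≤ c ∫₀^∞ g(s) ds. -/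
open MeasureTheory Set Real

/-- A concave function on `(0, ∞)` has a supergradient at every point. -/
lemma ConcaveOn.exists_supergradient {h : ℝ → ℝ} (hconc : ConcaveOn ℝ (Ioi 0) h) {a : ℝ}
    (ha : 0 < a) : ∃ m : ℝ, ∀ x, 0 < x → h x ≤ h a + m * (x - a) := by
  have key : ∀ x z, 0 < x → x < a → a < z → (h z - h a) / (z - a) ≤ (h a - h x) / (a - x) :=
    fun x z hx hxa haz => hconc.slope_anti_adjacent hx (ha.trans haz) hxa haz
  have hbdd : BddAbove ((fun z => (h z - h a) / (z - a)) '' Ioi a) :=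
    ⟨_, forall_mem_image.2 fun z hz => key (a / 2) z (by linarith) (by linarith) hz⟩
  refine ⟨sSup ((fun z => (h z - h a) / (z - a)) '' Ioi a), fun x hx => ?_⟩
  rcases lt_trichotomy x a with hxa | rfl | hxa
  · have h1 : sSup ((fun z => (h z - h a) / (z - a)) '' Ioi a) ≤ (h a - h x) / (a - x) :=
      csSup_le (nonempty_Ioi.image _) (forall_mem_image.2 fun z hz => key x z hx hxa hz)
    rw [le_div_iff₀ (by linarith)] at h1
    linarith
  · simp
  · have h1 := le_csSup hbdd (mem_image_of_mem _ (mem_Ioi.2 hxa))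
    rw [div_le_iff₀ (by linarith)] at h1
    linarith

/-- A strictly increasing concave function on `(0, ∞)` has a measurable selection of
supergradients, which is positive and decreasing. -/
lemma ConcaveOn.exists_measurable_supergradient {h : ℝ → ℝ} (hconc : ConcaveOn ℝ (Ioi 0) h)
    (hmono : StrictMonoOn h (Ioi 0)) :
    ∃ p : ℝ → ℝ, Measurable p ∧ (∀ a, 0 < a → 0 < p a) ∧ AntitoneOn p (Ioi 0) ∧
      ∀ a x, 0 < a → 0 < x → h x ≤ h a + p a * (x - a) := by
  choose! m hm using fun (a : ℝ) (ha : 0 < a) => hconc.exists_supergradient ha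
  have hpos : ∀ a, 0 < a → 0 < m a := fun a ha => by
    have h1 := hm a ha (2 * a) (by linarith)
    have h2 := hmono (mem_Ioi.2 ha) (mem_Ioi.2 (by linarith : 0 < 2 * a)) (by linarith)
    exact pos_of_mul_pos_left (by linarith : 0 < m a * a) ha.le
  have hanti : ∀ a b, 0 < a → a ≤ b → m b ≤ m a := fun a b ha hab => by
    rcases hab.eq_or_lt with rfl | hab
    · rfl
    have h1 := hm a ha b (ha.trans hab)
    have h2 := hm b (ha.trans hab) a ha
    nlinarith
  let q : ℝ → ENNReal := fun a => if 0 < a then ENNReal.ofReal (m a) else ⊤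
  have hq : Antitone q := fun a b hab => by
    by_cases ha : 0 < a
    · simpa [q, ha, ha.trans_le hab] using ENNReal.ofReal_le_ofReal (hanti a b ha hab)
    · simp [q, ha]
  have hqm : ∀ a, 0 < a → (q a).toReal = m a := fun a ha => by
    simp [q, ha, (hpos a ha).le]
  refine ⟨fun a => (q a).toReal, hq.measurable.ennreal_toReal, fun a ha => ?_,
    fun a ha b hb hab => ?_, fun a x ha hx => ?_⟩
  · simpa only [hqm a ha] using hpos a ha
  · simpa only [hqm a ha, hqm b hb] using hanti a b ha hab
  · simpa only [hqm a ha] using hm a ha x hx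

/-- Scaling of an integral over `(0, t)` to an integral over `(0, c)`. -/
lemma integral_comp_div_mul_Ioo {F : ℝ → ℝ} {c t : ℝ} (hc : 0 < c) (ht : 0 < t)
    (hF : IntegrableOn (fun u => F (1 / u)) (Ioo 0 c)) :
    IntegrableOn (fun s => F (t / (c * s))) (Ioo 0 t) ∧
      ∫ s in Ioo 0 t, F (t / (c * s)) = t / c * ∫ u in Ioo 0 c, F (1 / u) := by
  have htc : 0 < t / c := by positivity
  have himg : (fun u => t / c * u) '' Ioo 0 c = Ioo 0 t := by
    rw [image_mul_left_Ioo htc, mul_zero, div_mul_cancel₀ _ hc.ne']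
  have hderiv : ∀ x ∈ Ioo 0 c, HasDerivWithinAt (fun u => t / c * u) (t / c) (Ioo 0 c) x :=
    fun x _ => by simpa using ((hasDerivAt_id x).const_mul (t / c)).hasDerivWithinAt
  have hinj : InjOn (fun u => t / c * u) (Ioo 0 c) := (mul_right_injective₀ htc.ne').injOn
  have hcongr : ∀ u ∈ Ioo 0 c,
      t / c * F (1 / u) = |t / c| • F (t / (c * (t / c * u))) := fun u hu => by
    have hu0 : u ≠ 0 := hu.1.ne'
    rw [abs_of_pos htc, smul_eq_mul]
    congr 2
    field_simp
  rw [← himg, integrableOn_image_iff_integrableOn_abs_deriv_smul measurableSet_Ioo hderiv hinj,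
    integral_image_eq_integral_abs_deriv_smul measurableSet_Ioo hderiv hinj,
    ← integral_const_mul]
  exact ⟨IntegrableOn.congr_fun (hF.const_mul (t / c)) hcongr measurableSet_Ioo,
    (setIntegral_congr_fun measurableSet_Ioo hcongr).symm⟩

/-- Substitution `t = c * s / v` mapping `(0, c)` to `(s, ∞)`. -/
lemma lintegral_Ioi_comp_inversion (G : ℝ → ENNReal) {c s : ℝ} (hc : 0 < c) (hs : 0 < s) :
    ∫⁻ t in Ioi s, G t =
      ∫⁻ v in Ioo 0 c, ENNReal.ofReal (c * s / v ^ 2) * G (c * s / v) := by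
  have hcs : 0 < c * s := by positivity
  have himg : (fun v => c * s / v) '' Ioo 0 c = Ioi s := by
    ext x
    constructor
    · rintro ⟨v, hv, rfl⟩
      rw [mem_Ioi, lt_div_iff₀ hv.1, mul_comm]
      exact mul_lt_mul_of_pos_right hv.2 hs
    · intro hx
      have hx0 : 0 < x := hs.trans hx
      refine ⟨c * s / x, ⟨by positivity, ?_⟩, by field_simp⟩
      rw [div_lt_iff₀ hx0]
      exact mul_lt_mul_of_pos_left hx hc
  have hderiv : ∀ v ∈ Ioo 0 c,
      HasDerivWithinAt (fun v => c * s / v) (-(c * s / v ^ 2)) (Ioo 0 c) v := fun v hv => by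
    have := ((hasDerivAt_inv hv.1.ne').const_mul (c * s)).hasDerivWithinAt (s := Ioo 0 c)
    simpa [div_eq_mul_inv] using this
  have hinj : InjOn (fun v => c * s / v) (Ioo 0 c) := fun u hu v hv huv => by
    have hu0 := hu.1.ne'
    have hv0 := hv.1.ne'
    simp only at huv
    rw [div_eq_div_iff hu0 hv0] at huv
    exact (mul_left_cancel₀ hcs.ne' huv).symm
  rw [← himg, lintegral_image_eq_lintegral_abs_deriv_mul measurableSet_Ioo hderiv hinj]
  refine setLIntegral_congr_fun measurableSet_Ioo fun v hv => ?_
  have : 0 < v := hv.1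
  simp only [abs_neg]
  rw [abs_of_pos (by positivity)]

/-- Integral Hardy inequality for the deviation mean generated by
`E(x,y) = h(x/y)` with `h` strictly increasing and concave, `h(1) = 0`:
the Hardy constant is the unique `c > 0` with `∫₀^c h(1/t) dt = 0`. -/
theorem integral_hardy_deviation_mean
    (h : ℝ → ℝ) (hmono : StrictMonoOn h (Set.Ioi 0))
    (hconc : ConcaveOn ℝ (Set.Ioi 0) h) (h1 : h 1 = 0)
    (hint : IntegrableOn (fun t => h (1/t)) (Set.Ioo 0 1))
    (c : ℝ) (hc : 0 < c)
    (hcint : IntegrableOn (fun t => h (1/t)) (Set.Ioo 0 c))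
    (hczero : ∫ t in Set.Ioo (0:ℝ) c, h (1/t) = 0)
    (g : ℝ → ℝ) (hgint : IntegrableOn g (Set.Ioi 0))
    (hgpos : ∀ s ∈ Set.Ioi (0:ℝ), 0 < g s)
    (y : ℝ → ℝ)
    (hy : ∀ t ∈ Set.Ioi (0:ℝ), 0 < y t ∧
      IntegrableOn (fun s => h (g s / y t)) (Set.Ioo 0 t) ∧
      ∫ s in Set.Ioo (0:ℝ) t, h (g s / y t) = 0)
    (hymeas : AEMeasurable y (volume.restrict (Set.Ioi 0))) :
    ∫ t in Set.Ioi (0:ℝ), y t ≤ c * ∫ s in Set.Ioi (0:ℝ), g s := by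
  obtain ⟨p, hpm, hppos, hpanti, hp⟩ := hconc.exists_measurable_supergradient hmono
  have hKint : IntegrableOn (fun u => p (1 / u) * (1 / u)) (Ioo 0 c) := by
    have hdom : IntegrableOn (fun u => 2 * (h (1 / u) - h (1 / (2 * c)))) (Ioo 0 c) :=
      (hcint.sub (integrableOn_const (by simp))).const_mul 2
    refine Integrable.mono' hdom (by fun_prop) ?_
    filter_upwards [ae_restrict_mem measurableSet_Ioo] with u hu
    have hu0 : 0 < u := hu.1
    have h2 := hp (1 / u) (1 / (2 * u)) (by positivity) (by positivity)
    have h3 : h (1 / (2 * c)) ≤ h (1 / (2 * u)) :=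
      hmono.monotoneOn (by simp; positivity) (by simp; positivity)
        (one_div_le_one_div_of_le (by positivity) (by linarith [hu.2]))
    have h4 : 1 / (2 * u) - 1 / u = -(1 / 2) * (1 / u) := by field_simp; norm_num
    rw [h4] at h2
    have := hppos (1 / u) (by positivity)
    rw [norm_of_nonneg (by positivity)]
    linarith
  set K := ∫ u in Ioo 0 c, p (1 / u) * (1 / u) with hK
  have hppos' : ∀ u ∈ Ioo 0 c, 0 < p (1 / u) * (1 / u) := fun u hu => by
    have : 0 < u := hu.1
    have := hppos (1 / u) (by positivity)
    positivity
  have hKpos : 0 < K := by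
    rw [hK, setIntegral_pos_iff_support_of_nonneg_ae
      ((ae_restrict_mem measurableSet_Ioo).mono fun u hu => (hppos' u hu).le) hKint,
      inter_eq_self_of_subset_right fun u hu => Function.mem_support.2 (hppos' u hu).ne']
    simpa using hc
  have hJint : ∀ t, 0 < t → IntegrableOn (fun s => p (t / (c * s)) * g s) (Ioo 0 t) := by
    intro t ht
    refine (hgint.mono_set Ioo_subset_Ioi_self).bdd_mul (c := p (1 / c))
      (by fun_prop : Measurable fun s => p (t / (c * s))).aestronglyMeasurable ?_
    filter_upwards [ae_restrict_mem measurableSet_Ioo] with s hs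
    have hs0 : 0 < s := hs.1
    rw [norm_of_nonneg (hppos _ (by positivity)).le]
    refine hpanti (by simpa using hc) (by simp; positivity) ?_
    rw [div_le_div_iff₀ hc (by positivity)]
    nlinarith [hs.2]
  have hbound : ∀ t, 0 < t → y t ≤ ∫ s in Ioo 0 t, c / (K * t) * (p (t / (c * s)) * g s) := by
    intro t ht
    obtain ⟨hyt, hhi, hh0⟩ := hy t ht
    obtain ⟨hI1, hE1⟩ := integral_comp_div_mul_Ioo hc ht hcint
    obtain ⟨hI2, hE2⟩ := integral_comp_div_mul_Ioo (F := fun a => p a * a) hc ht hKint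
    have hJ := (hJint t ht).const_mul (1 / y t)
    have hsum : IntegrableOn (fun s => h (t / (c * s)) + 1 / y t * (p (t / (c * s)) * g s))
        (Ioo 0 t) := hI1.add hJ
    have hle : ∫ s in Ioo 0 t, h (g s / y t) ≤ ∫ s in Ioo 0 t,
        (h (t / (c * s)) + 1 / y t * (p (t / (c * s)) * g s)
          - p (t / (c * s)) * (t / (c * s))) := by
      refine setIntegral_mono_on hhi (hsum.sub hI2) measurableSet_Ioo fun s hs => ?_
      have hs0 : 0 < s := hs.1
      have := hp (t / (c * s)) (g s / y t) (by positivity) (div_pos (hgpos s hs0) hyt)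
      refine this.trans_eq ?_
      ring
    rw [hh0, integral_sub hsum hI2, integral_add hI1 hJ, hE1, hE2, hczero,
      integral_const_mul, ← hK] at hle
    rw [integral_const_mul]
    set J := ∫ s in Ioo 0 t, p (t / (c * s)) * g s
    have h5 : t / c * K ≤ J / y t := by
      rw [div_eq_mul_one_div J]
      linarith
    rw [le_div_iff₀ hyt] at h5
    calc y t = c / (K * t) * (t / c * K * y t) := by field_simp
      _ ≤ c / (K * t) * J := by gcongr
  let D : Set (ℝ × ℝ) := {z | z.2 < z.1}
  have hD : MeasurableSet D := measurableSet_lt measurable_snd measurable_fst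
  let Φ : ℝ → ℝ → ENNReal := fun t s =>
    D.indicator (fun z => ENNReal.ofReal (c / (K * z.1) * p (z.1 / (c * z.2)))) (t, s) *
      ENNReal.ofReal (g s)
  have hΦ : AEMeasurable (Function.uncurry Φ)
      ((volume.restrict (Ioi 0)).prod (volume.restrict (Ioi 0))) := by
    refine AEMeasurable.mul (Measurable.aemeasurable ?_) ?_
    · exact Measurable.indicator (by fun_prop) hD
    · exact (hgint.aemeasurable.ennreal_ofReal).comp_snd
  have hylint : ∫⁻ t in Ioi 0, ENNReal.ofReal (y t) ≤ ∫⁻ t in Ioi 0, ∫⁻ s in Ioi 0, Φ t s := by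
    refine setLIntegral_mono_ae' measurableSet_Ioi (ae_of_all _ fun t ht => ?_)
    have ht0 : 0 < t := ht
    refine (ENNReal.ofReal_le_ofReal (hbound t ht)).trans ?_
    rw [ofReal_integral_eq_lintegral_ofReal ((hJint t ht).const_mul _)]
    · refine le_trans (le_of_eq ?_) (lintegral_mono_set (Ioo_subset_Ioi_self : Ioo 0 t ⊆ Ioi 0))
      refine setLIntegral_congr_fun measurableSet_Ioo fun s hs => ?_
      have hs0 : 0 < s := hs.1
      have hpp := hppos (t / (c * s)) (by positivity)
      have hst : (t, s) ∈ D := hs.2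
      simp only [Φ, indicator_of_mem hst]
      rw [← ENNReal.ofReal_mul (by positivity), mul_assoc]
    · filter_upwards [ae_restrict_mem measurableSet_Ioo] with s hs
      have hs0 : 0 < s := hs.1
      have hpp := hppos (t / (c * s)) (by positivity)
      have := hgpos s hs0
      simp only [Pi.zero_apply]
      positivity
  have hinner : ∀ s, 0 < s →
      ∫⁻ t in Ioi 0, Φ t s = ENNReal.ofReal c * ENNReal.ofReal (g s) := by
    intro s hs
    have hind : ∀ t, D.indicator
        (fun z : ℝ × ℝ => ENNReal.ofReal (c / (K * z.1) * p (z.1 / (c * z.2)))) (t, s) =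
        (Ioi s).indicator (fun t => ENNReal.ofReal (c / (K * t) * p (t / (c * s)))) t :=
      fun t => rfl
    simp only [Φ]
    rw [lintegral_mul_const' _ _ ENNReal.ofReal_ne_top]
    congr 1
    simp only [hind]
    rw [setLIntegral_indicator measurableSet_Ioi,
      inter_eq_self_of_subset_left (Ioi_subset_Ioi hs.le), lintegral_Ioi_comp_inversion _ hc hs]
    have hcK : c = ∫ v in Ioo 0 c, c / K * (p (1 / v) * (1 / v)) := by
      rw [integral_const_mul, ← hK, div_mul_cancel₀ _ hKpos.ne']
    conv_rhs => rw [hcK]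
    rw [ofReal_integral_eq_lintegral_ofReal (hKint.const_mul _)]
    · refine setLIntegral_congr_fun measurableSet_Ioo fun v hv => ?_
      have hv0 : 0 < v := hv.1
      have hcv : c * s / v / (c * s) = 1 / v := by field_simp
      simp only [hcv]
      rw [← ENNReal.ofReal_mul (by positivity)]
      congr 1
      field_simp
    · filter_upwards [ae_restrict_mem measurableSet_Ioo] with v hv
      have := hppos' v hv
      simp only [Pi.zero_apply]
      positivity
  have hg0 : 0 ≤ᵐ[volume.restrict (Ioi 0)] g :=
    (ae_restrict_mem measurableSet_Ioi).mono fun s hs => (hgpos s hs).le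
  have hy0 : 0 ≤ᵐ[volume.restrict (Ioi 0)] y :=
    (ae_restrict_mem measurableSet_Ioi).mono fun t ht => (hy t ht).1.le
  rw [integral_eq_lintegral_of_nonneg_ae hy0 hymeas.aestronglyMeasurable]
  refine ENNReal.toReal_le_of_le_ofReal (mul_nonneg hc.le (integral_nonneg_of_ae hg0)) ?_
  calc ∫⁻ t in Ioi 0, ENNReal.ofReal (y t)
      ≤ ∫⁻ t in Ioi 0, ∫⁻ s in Ioi 0, Φ t s := hylint
    _ = ∫⁻ s in Ioi 0, ∫⁻ t in Ioi 0, Φ t s := lintegral_lintegral_swap hΦ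
    _ = ∫⁻ s in Ioi 0, ENNReal.ofReal c * ENNReal.ofReal (g s) :=
      setLIntegral_congr_fun measurableSet_Ioi fun s hs => hinner s hs
    _ = ENNReal.ofReal (c * ∫ s in Ioi 0, g s) := by
      rw [lintegral_const_mul' _ _ ENNReal.ofReal_ne_top, ENNReal.ofReal_mul hc.le,
        ofReal_integral_eq_lintegral_ofReal hgint hg0]
end
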